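/- arXiv:2409.17112 — 3 statements merged into one kernel-verified Lean document; each statement's English description precedes it below -/
import Mathlib

section
/- There exists a constant C' > 0 such that for all α ∈ (0, 1/2), ex(α) ≥ e^{C'·(log(1/α))^{1/7}}·α. -/
open Filter MeasureTheory Pointwise

/-- `exZMod p λ α` is the minimum of `|A + λ·A|/p` over all `A ⊆ ℤ/pℤ` with `|A| ≥ αp`,
where `A + λ·A = {a + λa' : a, a' ∈ A}`. -/
noncomputable def exZMod (p : ℕ) (lam : ℤ) (α : ℝ) : ℝ :=
  sInf {x : ℝ | ∃ A : Finset (ZMod p), α * p ≤ (A.card : ℝ) ∧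
    x = (((A + A.image fun a => (lam : ZMod p) * a).card : ℝ)) / p}

/-- `exLam λ α` is the limsup of `exZMod p λ α` over primes `p → ∞`. -/
noncomputable def exLam (lam : ℤ) (α : ℝ) : ℝ :=
  Filter.limsup (fun p => exZMod p lam α) (Filter.atTop ⊓ Filter.principal {p : ℕ | p.Prime})

/-- `exD α` is the limsup of `exLam λ α` as `λ → ∞`. -/
noncomputable def exD (α : ℝ) : ℝ :=
  Filter.limsup (fun lam : ℤ => exLam lam α) Filter.atTop

namespace DilateSum

section Entropy

variable {H : Type*} [Fintype H]

/-- Unnormalised relative entropy of `u` with respect to the uniform measure of the same mass. -/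
noncomputable def deficit (u : H → ℝ) : ℝ :=
  ∑ x, u x * Real.log (u x) - (∑ x, u x) * Real.log (∑ x, u x) +
    (∑ x, u x) * Real.log (Fintype.card H)

lemma sq_sqrt_sub_le {a b : ℝ} (ha : 0 ≤ a) (hb : 0 ≤ b) (hab : b = 0 → a = 0) :
    (√a - √b) ^ 2 + a - b ≤ a * Real.log a - a * Real.log b := by
  rcases ha.eq_or_lt with rfl | ha'
  · simp [Real.sq_sqrt hb]
  have hb' : 0 < b := hb.lt_of_ne fun h => ha'.ne' (hab h.symm)
  have sa : 0 < √a := Real.sqrt_pos.2 ha'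
  have sb : 0 < √b := Real.sqrt_pos.2 hb'
  have h1 : Real.log (√b / √a) ≤ √b / √a - 1 := Real.log_le_sub_one_of_pos (by positivity)
  rw [Real.log_div sb.ne' sa.ne', Real.log_sqrt hb, Real.log_sqrt ha] at h1
  have h2 : a * (Real.log b / 2 - Real.log a / 2) ≤ a * (√b / √a - 1) :=
    mul_le_mul_of_nonneg_left h1 ha
  have h3 : a * (√b / √a) = √a * √b := by
    nth_rewrite 1 [← Real.mul_self_sqrt ha]
    field_simp
  have h4 := Real.sq_sqrt ha
  have h5 := Real.sq_sqrt hb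
  nlinarith

lemma sub_le_mul_log_sub {a b : ℝ} (ha : 0 ≤ a) (hb : 0 ≤ b) (hab : b = 0 → a = 0) :
    a - b ≤ a * Real.log a - a * Real.log b := by
  have := sq_sqrt_sub_le ha hb hab
  nlinarith [sq_nonneg (√a - √b)]

lemma deficit_sum_le {J : Type*} [Fintype J] (c : J → ℝ) (hc : ∀ j, 0 ≤ c j) (u : J → H → ℝ)
    (hu : ∀ j x, 0 ≤ u j x) :
    deficit (fun x => ∑ j, c j * u j x) ≤ ∑ j, c j * deficit (u j) := by
  set U : H → ℝ := fun x => ∑ j, c j * u j x with hU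
  set m : J → ℝ := fun j => ∑ x, u j x with hm
  set M : ℝ := ∑ x, U x with hM
  have hm0 : ∀ j, 0 ≤ m j := fun j => Finset.sum_nonneg fun x _ => hu j x
  have hMm : M = ∑ j, c j * m j := by
    rw [hM, hU, Finset.sum_comm]
    exact Finset.sum_congr rfl fun j _ => by rw [hm, Finset.mul_sum]
  have hU0 : ∀ x, 0 ≤ U x := fun x => Finset.sum_nonneg fun j _ => mul_nonneg (hc j) (hu j x)
  have hM0 : 0 ≤ M := Finset.sum_nonneg fun x _ => hU0 x
  have key : ∀ j x, c j * (u j x - m j * U x / M) ≤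
      c j * (u j x * Real.log (u j x) - u j x * Real.log (m j) - u j x * Real.log (U x)
        + u j x * Real.log M) := by
    intro j x
    rcases (hc j).eq_or_lt with h0 | h0
    · simp [← h0]
    refine mul_le_mul_of_nonneg_left ?_ (hc j)
    rcases (hu j x).eq_or_lt with h1 | h1
    · have : 0 ≤ m j * U x / M := by have := hm0 j; have := hU0 x; positivity
      simp [← h1, this]
    have hmj : 0 < m j :=
      h1.trans_le (Finset.single_le_sum (f := u j) (fun x _ => hu j x) (Finset.mem_univ x))
    have hUx : 0 < U x := (mul_pos h0 h1).trans_le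
      (Finset.single_le_sum (f := fun j => c j * u j x) (fun j _ => mul_nonneg (hc j) (hu j x))
        (Finset.mem_univ j))
    have hMp : 0 < M :=
      hUx.trans_le (Finset.single_le_sum (f := U) (fun x _ => hU0 x) (Finset.mem_univ x))
    have := sub_le_mul_log_sub h1.le (b := m j * U x / M) (by positivity)
      (fun h => absurd h (by positivity))
    rw [Real.log_div (by positivity) hMp.ne', Real.log_mul hmj.ne' hUx.ne'] at this
    linarith
  have hsum := Finset.sum_le_sum fun (j : J) (_ : j ∈ Finset.univ) =>
    Finset.sum_le_sum fun (x : H) (_ : x ∈ Finset.univ) => key j x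
  have e1 : ∑ j, ∑ x, c j * (u j x - m j * U x / M) = 0 := by
    have : ∀ j, ∑ x, c j * (u j x - m j * U x / M) = c j * m j - c j * m j * (M / M) := by
      intro j
      rw [← Finset.mul_sum, Finset.sum_sub_distrib, ← Finset.sum_div, ← Finset.mul_sum]
      simp only [← hM, hm]
      ring
    simp only [this]
    rw [Finset.sum_sub_distrib, ← Finset.sum_mul, ← hMm]
    rcases eq_or_ne M 0 with h | h
    · simp [h]
    · rw [div_self h]; ring
  have e2 : ∑ j, ∑ x, c j * (u j x * Real.log (u j x) - u j x * Real.log (m j)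
        - u j x * Real.log (U x) + u j x * Real.log M) =
      ∑ j, c j * deficit (u j) - deficit U := by
    have h1 : ∑ x, U x * Real.log (U x) = ∑ j, ∑ x, c j * (u j x * Real.log (U x)) := by
      rw [Finset.sum_comm]
      refine Finset.sum_congr rfl fun x _ => ?_
      simp only [hU]
      rw [Finset.sum_mul]
      exact Finset.sum_congr rfl fun j _ => by ring
    have h2 : deficit U = ∑ x, U x * Real.log (U x) - M * Real.log M
        + M * Real.log (Fintype.card H) := rfl
    rw [h2, h1, hMm, Finset.sum_mul, Finset.sum_mul, ← Finset.sum_sub_distrib,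
      ← Finset.sum_add_distrib, ← Finset.sum_sub_distrib]
    refine Finset.sum_congr rfl fun j _ => ?_
    rw [← hMm, ← Finset.mul_sum, ← Finset.mul_sum, Finset.sum_add_distrib,
      Finset.sum_sub_distrib, Finset.sum_sub_distrib, ← Finset.sum_mul, ← Finset.sum_mul]
    simp only [deficit, hm]
    ring
  rw [e1, e2] at hsum
  linarith

lemma deficit_nonneg (u : H → ℝ) (hu : ∀ x, 0 ≤ u x) : 0 ≤ deficit u := by
  set m : ℝ := ∑ x, u x with hm
  have hm0 : 0 ≤ m := Finset.sum_nonneg fun x _ => hu x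
  have key : ∀ x, u x - m / Fintype.card H ≤
      u x * Real.log (u x) - u x * Real.log m + u x * Real.log (Fintype.card H) := by
    intro x
    have hcard : (0 : ℝ) < Fintype.card H := by
      exact_mod_cast Fintype.card_pos_iff.2 ⟨x⟩
    rcases (hu x).eq_or_lt with h1 | h1
    · have : 0 ≤ m / Fintype.card H := by positivity
      simp [← h1, this]
    have hmp : 0 < m :=
      h1.trans_le (Finset.single_le_sum (f := u) (fun x _ => hu x) (Finset.mem_univ x))
    have := sub_le_mul_log_sub h1.le (b := m / Fintype.card H) (by positivity)
      (fun h => absurd h (by positivity))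
    rw [Real.log_div hmp.ne' hcard.ne'] at this
    linarith
  have hs := Finset.sum_le_sum fun (x : H) (_ : x ∈ Finset.univ) => key x
  rw [Finset.sum_sub_distrib, Finset.sum_add_distrib, Finset.sum_sub_distrib, ← Finset.sum_mul,
    ← Finset.sum_mul, ← hm] at hs
  have : m - ∑ _x : H, m / Fintype.card H ≥ 0 := by
    rcases isEmpty_or_nonempty H with h | h
    · simp [hm0]
    · have : (Fintype.card H : ℝ) ≠ 0 := by simp
      simp only [Finset.sum_const, Finset.card_univ, nsmul_eq_mul]
      field_simp
      simp
  unfold deficit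
  linarith

lemma neg_log_card_le_sum_mul_log (u : H → ℝ) (hu : ∀ x, 0 ≤ u x) (h1 : ∑ x, u x = 1)
    (T : Finset H) (hT : ∀ x ∉ T, u x = 0) :
    -Real.log T.card ≤ ∑ x, u x * Real.log (u x) := by
  have hTs : ∑ x ∈ T, u x = 1 := by
    rw [← h1]; exact Finset.sum_subset (Finset.subset_univ T) fun x _ hx => hT x hx
  have hTn : T.Nonempty := by
    rw [Finset.nonempty_iff_ne_empty]; rintro rfl; simp at hTs
  have hcard : (0 : ℝ) < T.card := by exact_mod_cast hTn.card_pos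
  have e : ∑ x, u x * Real.log (u x) = ∑ x ∈ T, u x * Real.log (u x) := by
    refine (Finset.sum_subset (Finset.subset_univ T) fun x _ hx => ?_).symm
    simp [hT x hx]
  have key : ∀ x ∈ T, u x - 1 / T.card ≤ u x * Real.log (u x) + u x * Real.log T.card := by
    intro x _
    have := sub_le_mul_log_sub (hu x) (b := 1 / T.card) (by positivity)
      (fun h => absurd h (by positivity))
    rw [Real.log_div one_ne_zero hcard.ne', Real.log_one] at this
    linarith
  have hs := Finset.sum_le_sum key
  rw [Finset.sum_sub_distrib, Finset.sum_add_distrib, ← Finset.sum_mul, hTs] at hs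
  simp only [Finset.sum_const, nsmul_eq_mul] at hs
  rw [e]
  have : (T.card : ℝ) * (1 / T.card) = 1 := by field_simp
  linarith

lemma sum_mul_log_le_log (u : H → ℝ) (hu : ∀ x, 0 ≤ u x) (h1 : ∑ x, u x = 1) {B : ℝ}
    (hB : ∀ x, u x ≤ B) : ∑ x, u x * Real.log (u x) ≤ Real.log B := by
  rw [← one_mul (Real.log B), ← h1, Finset.sum_mul]
  refine Finset.sum_le_sum fun x _ => ?_
  rcases (hu x).eq_or_lt with h | h
  · simp [← h]
  · exact mul_le_mul_of_nonneg_left (Real.log_le_log h (hB x)) h.le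

lemma deficit_const_mul {c : ℝ} (hc : 0 < c) (u : H → ℝ) (hu : ∀ x, 0 ≤ u x) :
    deficit (fun x => c * u x) = c * deficit u := by
  have hlog : ∀ a : ℝ, 0 ≤ a → c * a * Real.log (c * a) =
      c * (a * Real.log a) + c * Real.log c * a := by
    intro a ha
    rcases ha.eq_or_lt with rfl | h
    · simp
    · rw [Real.log_mul hc.ne' h.ne']; ring
  unfold deficit
  rw [← Finset.mul_sum, hlog _ (Finset.sum_nonneg fun x _ => hu x)]
  simp only [hlog _ (hu _), Finset.sum_add_distrib, ← Finset.mul_sum]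
  ring

lemma deficit_zero : deficit (fun _ : H => (0 : ℝ)) = 0 := by simp [deficit]

end Entropy

section Convolution

variable {H : Type*} [AddCommGroup H] [Fintype H]

/-- Convolution on a finite abelian group with respect to counting measure. -/
noncomputable def dconv (u v : H → ℝ) : H → ℝ := fun x => ∑ y, u y * v (x - y)

lemma dconv_comm (u v : H → ℝ) : dconv u v = dconv v u := by
  funext x
  unfold dconv
  rw [← Equiv.sum_comp (Equiv.subLeft x)]
  exact Finset.sum_congr rfl fun y _ => by simp [mul_comm]

lemma dconv_nonneg {u v : H → ℝ} (hu : ∀ x, 0 ≤ u x) (hv : ∀ x, 0 ≤ v x) (x : H) :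
    0 ≤ dconv u v x :=
  Finset.sum_nonneg fun y _ => mul_nonneg (hu y) (hv _)

lemma sum_shift (u : H → ℝ) (y : H) : ∑ x, u (x - y) = ∑ x, u x :=
  Equiv.sum_comp (Equiv.subRight y) u

lemma sum_dconv (u v : H → ℝ) : ∑ x, dconv u v x = (∑ x, u x) * ∑ x, v x := by
  unfold dconv
  rw [Finset.sum_comm, Finset.sum_mul]
  exact Finset.sum_congr rfl fun y _ => by rw [← Finset.mul_sum, sum_shift]

lemma deficit_shift (u : H → ℝ) (y : H) : deficit (fun x => u (x - y)) = deficit u := by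
  unfold deficit
  rw [sum_shift u y, sum_shift (fun x => u x * Real.log (u x)) y]

lemma deficit_dconv_le (u v : H → ℝ) (hu : ∀ x, 0 ≤ u x) (hv : ∀ x, 0 ≤ v x) :
    deficit (dconv u v) ≤ (∑ x, v x) * deficit u := by
  rw [dconv_comm]
  refine (deficit_sum_le v hv (fun y x => u (x - y)) fun y x => hu _).trans_eq ?_
  simp only [deficit_shift, Finset.sum_mul]

lemma deficit_dconv_le' (u v : H → ℝ) (hu : ∀ x, 0 ≤ u x) (hv : ∀ x, 0 ≤ v x) :
    deficit (dconv u v) ≤ (∑ x, u x) * deficit v := by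
  rw [dconv_comm]; exact deficit_dconv_le v u hv hu

end Convolution

section Contraction

variable {H : Type*} [AddCommGroup H] [Fintype H]

lemma sum_max_dconv_le (k v : H → ℝ) (hk : ∑ x, k x ≤ 0) (hv : ∀ x, 0 ≤ v x)
    (hv1 : ∀ t, ∑ x, |v x - v (x - t)| ≤ 1) :
    ∑ x, max (dconv k v x) 0 ≤ 1 / 2 * ∑ x, max (k x) 0 := by
  set a : H → ℝ := fun x => max (k x) 0 with ha
  set b : H → ℝ := fun x => max (-k x) 0 with hb
  have ha0 : ∀ x, 0 ≤ a x := fun x => le_max_right _ _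
  have hb0 : ∀ x, 0 ≤ b x := fun x => le_max_right _ _
  have hab : ∀ x, k x = a x - b x := fun x => by
    simp only [ha, hb]
    rcases le_total 0 (k x) with h | h
    · rw [max_eq_left h, max_eq_right (by linarith)]; ring
    · rw [max_eq_right h, max_eq_left (by linarith)]; ring
  set A : ℝ := ∑ x, a x with hA
  set B : ℝ := ∑ x, b x with hB
  have hA0 : 0 ≤ A := Finset.sum_nonneg fun x _ => ha0 x
  have hAB : A ≤ B := by
    have : ∑ x, k x = A - B := by simp only [hab, Finset.sum_sub_distrib, hA, hB]
    linarith
  have hconv : ∀ x, dconv k v x = dconv a v x - dconv b v x := fun x => by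
    simp only [dconv, hab, sub_mul, Finset.sum_sub_distrib]
  rcases hA0.eq_or_lt with h0 | h0
  · have haz : ∀ x, a x = 0 := fun x =>
      (Finset.sum_eq_zero_iff_of_nonneg fun x _ => ha0 x).1 h0.symm x (Finset.mem_univ x)
    rw [← h0, mul_zero]
    refine (Finset.sum_eq_zero fun x _ => max_eq_right ?_).le
    rw [hconv]
    have : dconv a v x = 0 := by simp [dconv, haz]
    linarith [dconv_nonneg hb0 hv x]
  have hBp : 0 < B := h0.trans_le hAB
  have hpt : ∀ x, B * max (dconv k v x) 0 ≤
      ∑ y, ∑ z, a y * b z * max (v (x - y) - v (x - z)) 0 := by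
    intro x
    have h1 : ∑ y, ∑ z, a y * b z * (v (x - y) - v (x - z)) =
        B * dconv a v x - A * dconv b v x := by
      simp only [mul_sub, Finset.sum_sub_distrib]
      congr 1
      · rw [hB, dconv, Finset.sum_mul_sum, Finset.sum_comm]
        exact Finset.sum_congr rfl fun _ _ => Finset.sum_congr rfl fun _ _ => by ring
      · rw [hA, dconv, Finset.sum_mul_sum]
        exact Finset.sum_congr rfl fun _ _ => Finset.sum_congr rfl fun _ _ => by ring
    have h2 : ∑ y, ∑ z, a y * b z * (v (x - y) - v (x - z)) ≤
        ∑ y, ∑ z, a y * b z * max (v (x - y) - v (x - z)) 0 :=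
      Finset.sum_le_sum fun y _ => Finset.sum_le_sum fun z _ =>
        mul_le_mul_of_nonneg_left (le_max_left _ _) (mul_nonneg (ha0 y) (hb0 z))
    have h3 : 0 ≤ ∑ y, ∑ z, a y * b z * max (v (x - y) - v (x - z)) 0 :=
      Finset.sum_nonneg fun y _ => Finset.sum_nonneg fun z _ =>
        mul_nonneg (mul_nonneg (ha0 y) (hb0 z)) (le_max_right _ _)
    rw [mul_max_of_nonneg _ _ hBp.le, mul_zero]
    refine max_le ?_ h3
    rw [hconv, mul_sub]
    have := mul_le_mul_of_nonneg_right hAB (dconv_nonneg hb0 hv x)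
    linarith
  have hshift : ∀ y z, ∑ x, max (v (x - y) - v (x - z)) 0 ≤ 1 / 2 := by
    intro y z
    have h1 : ∀ x, max (v (x - y) - v (x - z)) 0 =
        (|v (x - y) - v (x - z)| + (v (x - y) - v (x - z))) / 2 := fun x => by
      rcases le_total 0 (v (x - y) - v (x - z)) with h | h
      · rw [max_eq_left h, abs_of_nonneg h]; ring
      · rw [max_eq_right h, abs_of_nonpos h]; ring
    have h2 : ∑ x, |v (x - y) - v (x - z)| ≤ 1 := by
      refine le_trans (le_of_eq ?_) (hv1 (z - y))
      rw [← Equiv.sum_comp (Equiv.subRight y) fun x => |v x - v (x - (z - y))|]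
      exact Finset.sum_congr rfl fun x _ => by simp
    simp only [h1]
    rw [← Finset.sum_div, Finset.sum_add_distrib, Finset.sum_sub_distrib, sum_shift, sum_shift]
    linarith
  have hs := Finset.sum_le_sum fun (x : H) (_ : x ∈ Finset.univ) => hpt x
  rw [← Finset.mul_sum, Finset.sum_comm] at hs
  have hs2 : ∑ y, ∑ x, ∑ z, a y * b z * max (v (x - y) - v (x - z)) 0 ≤ A * B * (1 / 2) := by
    rw [hA, hB, Finset.sum_mul_sum, Finset.sum_mul]
    refine Finset.sum_le_sum fun y _ => ?_
    rw [Finset.sum_comm, Finset.sum_mul]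
    refine Finset.sum_le_sum fun z _ => ?_
    rw [← Finset.mul_sum]
    exact mul_le_mul_of_nonneg_left (hshift y z) (mul_nonneg (ha0 y) (hb0 z))
  have hfin : B * ∑ x, max (dconv k v x) 0 ≤ B * (1 / 2 * A) := by linarith
  exact le_of_mul_le_mul_left hfin hBp

lemma intervalIntegrable_hinge_low (x : ℝ) (hx : 0 ≤ x) :
    IntervalIntegrable (fun s : ℝ => max (1 - x / s) 0) volume 0 1 := by
  rw [intervalIntegrable_iff_integrableOn_Ioc_of_le zero_le_one]
  refine Measure.integrableOn_of_bounded (M := 1) (by simp) ?_ ?_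
  · exact Measurable.aestronglyMeasurable (by fun_prop)
  · refine (ae_restrict_iff' measurableSet_Ioc).2 (ae_of_all _ fun s hs => ?_)
    rw [Real.norm_eq_abs, abs_of_nonneg (le_max_right _ _)]
    refine max_le ?_ zero_le_one
    have := div_nonneg hx hs.1.le
    linarith

lemma intervalIntegrable_hinge_high (x : ℝ) {M : ℝ} (hM : 1 ≤ M) :
    IntervalIntegrable (fun s : ℝ => max (x / s - 1) 0) volume 1 M := by
  refine ContinuousOn.intervalIntegrable ?_
  rw [Set.uIcc_of_le hM]
  refine ContinuousOn.sup ?_ continuousOn_const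
  refine ContinuousOn.sub (ContinuousOn.div continuousOn_const continuousOn_id fun s hs => ?_)
    continuousOn_const
  have := hs.1
  linarith

lemma integral_hinge_low {x : ℝ} (hx : 0 ≤ x) :
    ∫ s in (0 : ℝ)..1, max (1 - x / s) 0 =
      if x ≤ 1 then x * Real.log x - x + 1 else 0 := by
  have hzero : ∀ y : ℝ, 0 ≤ y → y ≤ x → ∫ s in (0 : ℝ)..y, max (1 - x / s) 0 = 0 := by
    intro y hy hyx
    rw [intervalIntegral.integral_of_le hy, setIntegral_eq_zero_of_forall_eq_zero]
    intro s hs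
    refine max_eq_right ?_
    have : 1 ≤ x / s := by rw [le_div_iff₀ hs.1]; linarith [hs.2]
    linarith
  split_ifs with h
  · rcases hx.eq_or_lt with rfl | hx0
    · simp
    have hi := intervalIntegrable_hinge_low x hx
    rw [← intervalIntegral.integral_add_adjacent_intervals (b := x)
      (hi.mono_set (by rw [Set.uIcc_of_le hx, Set.uIcc_of_le zero_le_one]
                       exact Set.Icc_subset_Icc_right h))
      (hi.mono_set (by rw [Set.uIcc_of_le h, Set.uIcc_of_le zero_le_one]
                       exact Set.Icc_subset_Icc_left hx)), hzero x hx le_rfl, zero_add]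
    have : ∫ s in x..1, max (1 - x / s) 0 = ∫ s in x..1, (1 - x * s⁻¹) := by
      refine intervalIntegral.integral_congr fun s hs => ?_
      rw [Set.uIcc_of_le h] at hs
      have hs0 : 0 < s := hx0.trans_le hs.1
      have : x / s ≤ 1 := by rw [div_le_one hs0]; exact hs.1
      rw [max_eq_left (by linarith), div_eq_mul_inv]
    rw [this, intervalIntegral.integral_sub (by simp), intervalIntegral.integral_const_mul,
      integral_inv_of_pos hx0 one_pos]
    · simp; ring
    · refine (intervalIntegral.intervalIntegrable_inv (fun s hs => ?_)
        continuousOn_id).const_mul _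
      rw [Set.uIcc_of_le h] at hs
      exact (hx0.trans_le hs.1).ne'
  · exact hzero 1 zero_le_one (not_le.1 h).le

lemma integral_hinge_high {x M : ℝ} (hM : 1 ≤ M) (hxM : x ≤ M) :
    ∫ s in (1 : ℝ)..M, max (x / s - 1) 0 =
      if x ≤ 1 then 0 else x * Real.log x - x + 1 := by
  have hzero : ∀ y : ℝ, 1 ≤ y → x ≤ y → ∫ s in y..M, max (x / s - 1) 0 = 0 := by
    intro y hy hyx
    rcases le_total y M with hyM | hyM
    · rw [intervalIntegral.integral_of_le hyM, setIntegral_eq_zero_of_forall_eq_zero]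
      intro s hs
      refine max_eq_right ?_
      have hs0 : 0 < s := by linarith [hs.1]
      have : x / s ≤ 1 := by rw [div_le_one hs0]; linarith [hs.1]
      linarith
    · rw [intervalIntegral.integral_of_ge hyM, setIntegral_eq_zero_of_forall_eq_zero, neg_zero]
      intro s hs
      refine max_eq_right ?_
      have hs0 : 0 < s := by linarith [hs.1]
      have : x / s ≤ 1 := by rw [div_le_one hs0]; linarith [hs.1]
      linarith
  split_ifs with h
  · exact hzero 1 le_rfl h
  · have h1 : 1 ≤ x := (not_le.1 h).le
    have hx0 : 0 < x := by linarith
    have hi := intervalIntegrable_hinge_high x hM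
    rw [← intervalIntegral.integral_add_adjacent_intervals (b := x)
      (hi.mono_set (by rw [Set.uIcc_of_le h1, Set.uIcc_of_le hM]
                       exact Set.Icc_subset_Icc_right hxM))
      (hi.mono_set (by rw [Set.uIcc_of_le hxM, Set.uIcc_of_le hM]
                       exact Set.Icc_subset_Icc_left h1)), hzero x h1 le_rfl, add_zero]
    have : ∫ s in (1 : ℝ)..x, max (x / s - 1) 0 = ∫ s in (1 : ℝ)..x, (x * s⁻¹ - 1) := by
      refine intervalIntegral.integral_congr fun s hs => ?_
      rw [Set.uIcc_of_le h1] at hs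
      have hs0 : 0 < s := by linarith [hs.1]
      have : 1 ≤ x / s := by rw [le_div_iff₀ hs0]; linarith [hs.2]
      rw [max_eq_left (by linarith), div_eq_mul_inv]
    rw [this, intervalIntegral.integral_sub _ (by simp), intervalIntegral.integral_const_mul,
      integral_inv_of_pos one_pos hx0]
    · simp; ring
    · refine (intervalIntegral.intervalIntegrable_inv (fun s hs => ?_)
        continuousOn_id).const_mul _
      rw [Set.uIcc_of_le h1] at hs
      exact (one_pos.trans_le hs.1).ne'

lemma mul_log_sub_add_one_eq {x M : ℝ} (hx : 0 ≤ x) (hM : 1 ≤ M) (hxM : x ≤ M) :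
    x * Real.log x - x + 1 = (∫ s in (0 : ℝ)..1, max (1 - x / s) 0) +
      ∫ s in (1 : ℝ)..M, max (x / s - 1) 0 := by
  rw [integral_hinge_low hx, integral_hinge_high hM hxM]
  split_ifs <;> ring

lemma dconv_const [Nonempty H] (c : ℝ) (v : H → ℝ) (hv : ∑ x, v x = 1) (x : H) :
    dconv (fun _ => c) v x = c := by
  rw [dconv_comm, dconv, ← Finset.sum_mul, hv, one_mul]

/-- If translates of `v` are pairwise close in total variation, then convolution with `v`
contracts relative entropy. -/
lemma deficit_dconv_le_half (u v : H → ℝ) (hu : ∀ x, 0 ≤ u x) (hv : ∀ x, 0 ≤ v x)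
    (hu1 : ∑ x, u x = 1) (hvs : ∑ x, v x = 1) (hv1 : ∀ t, ∑ x, |v x - v (x - t)| ≤ 1) :
    deficit (dconv u v) ≤ 1 / 2 * deficit u := by
  classical
  have : Nonempty H := ⟨0⟩
  set q : ℝ := ((Fintype.card H : ℕ) : ℝ) with hq
  have hq1 : 1 ≤ q := by
    rw [hq]; exact_mod_cast Fintype.card_pos
  have hq0 : 0 < q := by linarith
  have hrepr : ∀ w : H → ℝ, (∀ x, 0 ≤ w x) → ∑ x, w x = 1 →
      q * deficit w = (∫ s in (0 : ℝ)..1, ∑ x, max (1 - q * w x / s) 0) +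
        ∫ s in (1 : ℝ)..q, ∑ x, max (q * w x / s - 1) 0 := by
    intro w hw hw1
    have hwq : ∀ x, q * w x ≤ q := fun x => by
      have : w x ≤ 1 := hw1 ▸ Finset.single_le_sum (fun x _ => hw x) (Finset.mem_univ x)
      nlinarith
    rw [intervalIntegral.integral_finsetSum fun x _ =>
        intervalIntegrable_hinge_low (q * w x) (mul_nonneg hq0.le (hw x)),
      intervalIntegral.integral_finsetSum fun x _ =>
        intervalIntegrable_hinge_high (q * w x) hq1, ← Finset.sum_add_distrib]
    rw [Finset.sum_congr rfl fun x _ => (mul_log_sub_add_one_eq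
      (mul_nonneg hq0.le (hw x)) hq1 (hwq x)).symm]
    rw [Finset.sum_add_distrib, Finset.sum_sub_distrib, ← Finset.mul_sum, hw1]
    have : ∀ x, q * w x * Real.log (q * w x) =
        q * (w x * Real.log (w x)) + q * (w x * Real.log q) := by
      intro x
      rcases (hw x).eq_or_lt with h | h
      · simp [← h]
      · rw [Real.log_mul hq0.ne' h.ne']; ring
    simp only [this]
    rw [Finset.sum_add_distrib, ← Finset.mul_sum, ← Finset.mul_sum, ← Finset.sum_mul, hw1]
    unfold deficit
    rw [hw1]
    simp [← hq]
    ring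
  have hw1 : ∑ x, dconv u v x = 1 := by rw [sum_dconv, hu1, hvs, one_mul]
  have hlin : ∀ (α β : ℝ) x, dconv (fun y => α + β * u y) v x = α + β * dconv u v x := by
    intro α β x
    have := dconv_const α v hvs x
    simp only [dconv, add_mul, Finset.sum_add_distrib] at this ⊢
    rw [this, Finset.mul_sum]
    congr 1
    exact Finset.sum_congr rfl fun _ _ => by ring
  have hlow : ∀ s ∈ Set.Ioo (0 : ℝ) 1, ∑ x, max (1 - q * dconv u v x / s) 0 ≤
      1 / 2 * ∑ x, max (1 - q * u x / s) 0 := by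
    intro s hs
    have h := sum_max_dconv_le (fun y => 1 + (-q / s) * u y) v ?_ hv hv1
    · simp only [hlin] at h
      convert h using 4 <;> ring_nf
    · rw [Finset.sum_add_distrib, ← Finset.mul_sum, hu1]
      simp only [Finset.sum_const, Finset.card_univ, nsmul_eq_mul, mul_one, ← hq]
      have : q ≤ q / s := by rw [le_div_iff₀ hs.1]; nlinarith [hs.2]
      have e : -q / s = -(q / s) := by ring
      linarith
  have hhigh : ∀ s ∈ Set.Ioo (1 : ℝ) q, ∑ x, max (q * dconv u v x / s - 1) 0 ≤
      1 / 2 * ∑ x, max (q * u x / s - 1) 0 := by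
    intro s hs
    have h := sum_max_dconv_le (fun y => -1 + (q / s) * u y) v ?_ hv hv1
    · simp only [hlin] at h
      convert h using 4 <;> ring_nf
    · rw [Finset.sum_add_distrib, ← Finset.mul_sum, hu1]
      simp only [Finset.sum_const, Finset.card_univ, nsmul_eq_mul, mul_one, ← hq]
      have : q / s ≤ q := by rw [div_le_iff₀ (by linarith [hs.1])]; nlinarith [hs.1]
      linarith
  have hlowint : ∀ w : H → ℝ, (∀ x, 0 ≤ w x) → IntervalIntegrable
      (fun s : ℝ => ∑ x, max (1 - q * w x / s) 0) volume 0 1 := fun w hw => by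
    have := IntervalIntegrable.sum Finset.univ (μ := volume) (a := 0) (b := 1)
      (f := fun x (s : ℝ) => max (1 - q * w x / s) 0)
      fun x _ => intervalIntegrable_hinge_low (q * w x) (mul_nonneg hq0.le (hw x))
    rw [Finset.sum_fn] at this
    exact this
  have hhighint : ∀ w : H → ℝ, IntervalIntegrable
      (fun s : ℝ => ∑ x, max (q * w x / s - 1) 0) volume 1 q := fun w => by
    have := IntervalIntegrable.sum Finset.univ (μ := volume) (a := 1) (b := q)
      (f := fun x (s : ℝ) => max (q * w x / s - 1) 0)
      fun x _ => intervalIntegrable_hinge_high (q * w x) hq1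
    rw [Finset.sum_fn] at this
    exact this
  have hw0 := dconv_nonneg hu hv
  have i1 := intervalIntegral.integral_mono_on_of_le_Ioo zero_le_one (hlowint _ hw0)
    ((hlowint u hu).const_mul (1 / 2)) hlow
  have i2 := intervalIntegral.integral_mono_on_of_le_Ioo hq1 (hhighint (dconv u v))
    ((hhighint u).const_mul (1 / 2)) hhigh
  rw [intervalIntegral.integral_const_mul] at i1 i2
  have r1 := hrepr _ hw0 hw1
  have r2 := hrepr u hu hu1
  have : q * deficit (dconv u v) ≤ q * (1 / 2 * deficit u) := by linarith
  exact le_of_mul_le_mul_left this hq0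

end Contraction

section Translates

variable {H : Type*} [AddCommGroup H] [Fintype H]

/-- Total variation distance (up to a factor of two) between `u` and its translate by `t`. -/
noncomputable def tv (u : H → ℝ) (t : H) : ℝ := ∑ x, |u x - u (x - t)|

lemma tv_nonneg (u : H → ℝ) (t : H) : 0 ≤ tv u t := Finset.sum_nonneg fun _ _ => abs_nonneg _

lemma tv_zero (u : H → ℝ) : tv u 0 = 0 := by simp [tv]

lemma tv_sub (u : H → ℝ) (s t : H) : tv u (s - t) = ∑ x, |u (x - t) - u (x - s)| := by
  unfold tv
  rw [← Equiv.sum_comp (Equiv.subRight t)]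
  exact Finset.sum_congr rfl fun x _ => by simp

lemma tv_add_le (u : H → ℝ) (s t : H) : tv u (s + t) ≤ tv u s + tv u t := by
  have h : tv u s = ∑ x, |u (x - t) - u (x - (s + t))| := by
    rw [← tv_sub, add_sub_cancel_right]
  rw [h]
  unfold tv
  rw [← Finset.sum_add_distrib]
  refine Finset.sum_le_sum fun x _ => ?_
  linarith [abs_sub_le (u x) (u (x - t)) (u (x - (s + t)))]

lemma sq_sum_abs_sub_le {ι : Type*} [Fintype ι] (p q : ι → ℝ) (hp : ∀ x, 0 ≤ p x)
    (hq : ∀ x, 0 ≤ q x) (hp1 : ∑ x, p x = 1) (hq1 : ∑ x, q x = 1) :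
    (∑ x, |p x - q x|) ^ 2 ≤ 4 * ∑ x, (√(p x) - √(q x)) ^ 2 := by
  have h := Finset.sum_mul_sq_le_sq_mul_sq Finset.univ (fun x => |√(p x) - √(q x)|)
    fun x => √(p x) + √(q x)
  have e : ∀ x, |√(p x) - √(q x)| * (√(p x) + √(q x)) = |p x - q x| := by
    intro x
    rw [← abs_of_nonneg (add_nonneg (Real.sqrt_nonneg (p x)) (Real.sqrt_nonneg (q x))), ← abs_mul]
    congr 1
    nlinarith [Real.sq_sqrt (hp x), Real.sq_sqrt (hq x)]
  have e2 : ∑ x, (√(p x) + √(q x)) ^ 2 ≤ 4 := by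
    calc ∑ x, (√(p x) + √(q x)) ^ 2 ≤ ∑ x, (2 * p x + 2 * q x) :=
          Finset.sum_le_sum fun x _ => by
            nlinarith [Real.sq_sqrt (hp x), Real.sq_sqrt (hq x), sq_nonneg (√(p x) - √(q x))]
      _ = 4 := by
        rw [Finset.sum_add_distrib, ← Finset.mul_sum, ← Finset.mul_sum, hp1, hq1]; norm_num
  simp only [e, sq_abs] at h
  have h0 : 0 ≤ ∑ x, (√(p x) - √(q x)) ^ 2 := Finset.sum_nonneg fun _ _ => sq_nonneg _
  nlinarith

lemma sum_mul_sq_sqrt_sub_le (u v : H → ℝ) (hu : ∀ x, 0 ≤ u x) (hv : ∀ x, 0 ≤ v x)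
    (hu1 : ∑ x, u x = 1) (hv1 : ∑ x, v x = 1) :
    ∑ y, v y * ∑ x, (√(u (x - y)) - √(dconv u v x)) ^ 2 ≤ deficit u - deficit (dconv u v) := by
  set w := dconv u v with hw
  have hw0 : ∀ x, 0 ≤ w x := dconv_nonneg hu hv
  have hw1 : ∑ x, w x = 1 := by rw [hw, sum_dconv, hu1, hv1, one_mul]
  have e : deficit u - deficit w =
      ∑ y, v y * ∑ x, (u (x - y) * Real.log (u (x - y)) - u (x - y) * Real.log (w x)) := by
    simp only [Finset.sum_sub_distrib, mul_sub]
    have h1 : ∑ y, v y * ∑ x, u (x - y) * Real.log (u (x - y)) = ∑ x, u x * Real.log (u x) := by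
      have : ∀ y, ∑ x, u (x - y) * Real.log (u (x - y)) = ∑ x, u x * Real.log (u x) :=
        fun y => sum_shift (fun x => u x * Real.log (u x)) y
      simp only [this]
      rw [← Finset.sum_mul, hv1, one_mul]
    have h2 : ∑ y, v y * ∑ x, u (x - y) * Real.log (w x) = ∑ x, w x * Real.log (w x) := by
      simp only [Finset.mul_sum]
      rw [Finset.sum_comm]
      refine Finset.sum_congr rfl fun x _ => ?_
      have : w x = ∑ y, v y * u (x - y) := by rw [hw, dconv_comm]; rfl
      conv_rhs => rw [this]
      rw [Finset.sum_mul]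
      simp only [← this, mul_assoc]
    rw [h1, h2]
    unfold deficit
    rw [hu1, hw1]
    ring
  rw [e]
  refine Finset.sum_le_sum fun y _ => ?_
  rcases (hv y).eq_or_lt with h | h
  · simp [← h]
  refine mul_le_mul_of_nonneg_left ?_ h.le
  have hz : ∀ x, w x = 0 → u (x - y) = 0 := by
    intro x hx
    rw [hw, dconv_comm] at hx
    have := (Finset.sum_eq_zero_iff_of_nonneg
      fun z _ => mul_nonneg (hv z) (hu (x - z))).1 hx y (Finset.mem_univ y)
    exact (mul_eq_zero.1 this).resolve_left h.ne'
  have hs := Finset.sum_le_sum fun (x : H) (_ : x ∈ Finset.univ) =>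
    sq_sqrt_sub_le (hu (x - y)) (hw0 x) (hz x)
  rw [Finset.sum_sub_distrib, Finset.sum_add_distrib, sum_shift, hu1, hw1] at hs
  linarith

lemma sq_sum_mul_tv_le (u v : H → ℝ) (hu : ∀ x, 0 ≤ u x) (hv : ∀ x, 0 ≤ v x)
    (hu1 : ∑ x, u x = 1) (hv1 : ∑ x, v x = 1) :
    (∑ y, ∑ z, v y * v z * tv u (y - z)) ^ 2 ≤ 16 * (deficit u - deficit (dconv u v)) := by
  set w := dconv u v with hw
  have hw0 : ∀ x, 0 ≤ w x := dconv_nonneg hu hv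
  have hw1 : ∑ x, w x = 1 := by rw [hw, sum_dconv, hu1, hv1, one_mul]
  set T : H → ℝ := fun y => ∑ x, |u (x - y) - w x| with hT
  have hT0 : ∀ y, 0 ≤ T y := fun y => Finset.sum_nonneg fun _ _ => abs_nonneg _
  have h1 : ∑ y, ∑ z, v y * v z * tv u (y - z) ≤ 2 * ∑ y, v y * T y := by
    have : ∀ y z, v y * v z * tv u (y - z) ≤ v y * T y * v z + v y * (v z * T z) := by
      intro y z
      have : tv u (y - z) ≤ T y + T z := by
        rw [tv_sub, hT, ← Finset.sum_add_distrib]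
        refine Finset.sum_le_sum fun x _ => ?_
        rw [add_comm, abs_sub_comm (u (x - y))]
        exact abs_sub_le _ _ _
      calc v y * v z * tv u (y - z) ≤ v y * v z * (T y + T z) :=
            mul_le_mul_of_nonneg_left this (mul_nonneg (hv y) (hv z))
        _ = _ := by ring
    refine (Finset.sum_le_sum fun y _ => Finset.sum_le_sum fun z _ => this y z).trans_eq ?_
    simp only [Finset.sum_add_distrib, ← Finset.mul_sum, ← Finset.sum_mul, hv1]
    ring
  have h2 : (∑ y, v y * T y) ^ 2 ≤ ∑ y, v y * T y ^ 2 := by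
    have h := Finset.sum_mul_sq_le_sq_mul_sq Finset.univ (fun y => √(v y)) fun y => √(v y) * T y
    have e1 : ∀ y, √(v y) * (√(v y) * T y) = v y * T y := fun y => by
      rw [← mul_assoc, Real.mul_self_sqrt (hv y)]
    simp only [e1, mul_pow, Real.sq_sqrt (hv _), hv1, one_mul] at h
    exact h
  have h3 : ∑ y, v y * T y ^ 2 ≤ 4 * (deficit u - deficit w) := by
    refine le_trans ?_ (mul_le_mul_of_nonneg_left (sum_mul_sq_sqrt_sub_le u v hu hv hu1 hv1)
      (by norm_num : (0 : ℝ) ≤ 4))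
    rw [Finset.mul_sum]
    refine Finset.sum_le_sum fun y _ => ?_
    have := sq_sum_abs_sub_le (fun x => u (x - y)) w (fun x => hu _) hw0
      (by rw [sum_shift, hu1]) hw1
    calc v y * T y ^ 2 ≤ v y * (4 * ∑ x, (√(u (x - y)) - √(w x)) ^ 2) :=
          mul_le_mul_of_nonneg_left this (hv y)
      _ = _ := by ring
  have h0 : 0 ≤ ∑ y, ∑ z, v y * v z * tv u (y - z) :=
    Finset.sum_nonneg fun y _ => Finset.sum_nonneg fun z _ =>
      mul_nonneg (mul_nonneg (hv y) (hv z)) (tv_nonneg _ _)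
  nlinarith [pow_le_pow_left₀ h0 h1 2]

open Classical in
/-- The set of approximate periods of `u`. -/
noncomputable def almostPeriods (u : H → ℝ) (η : ℝ) : Finset H :=
  Finset.univ.filter fun t => tv u t ≤ η

lemma mem_almostPeriods {u : H → ℝ} {η : ℝ} {t : H} : t ∈ almostPeriods u η ↔ tv u t ≤ η := by
  simp [almostPeriods]

open Classical in
lemma le_sum_mul_ite (u v : H → ℝ) (hv : ∀ x, 0 ≤ v x) (hv1 : ∑ x, v x = 1)
    (h : ∑ y, ∑ z, v y * v z * tv u (y - z) ≤ 1 / 200) :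
    9 / 10 ≤ ∑ y, ∑ z, v y * v z * if y - z ∈ almostPeriods u (1 / 20) then 1 else 0 := by
  have key : ∀ y z, v y * v z - 20 * (v y * v z * tv u (y - z)) ≤
      v y * v z * if y - z ∈ almostPeriods u (1 / 20) then 1 else 0 := by
    intro y z
    have h0 := mul_nonneg (hv y) (hv z)
    split_ifs with hm
    · have := mul_nonneg h0 (tv_nonneg u (y - z)); linarith
    · rw [mem_almostPeriods, not_le] at hm
      nlinarith
  have hs := Finset.sum_le_sum fun (y : H) (_ : y ∈ Finset.univ) =>
    Finset.sum_le_sum fun (z : H) (_ : z ∈ Finset.univ) => key y z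
  simp only [Finset.sum_sub_distrib, ← Finset.mul_sum] at hs
  simp only [Finset.mul_sum] at hs
  rw [← Finset.sum_mul_sum, hv1] at hs
  simp only [← Finset.mul_sum] at hs h ⊢
  linarith

lemma card_almostPeriods_le (u v : H → ℝ) (hv : ∀ x, 0 ≤ v x) (hv1 : ∑ x, v x = 1)
    (h : ∑ y, ∑ z, v y * v z * tv u (y - z) ≤ 1 / 200) :
    4 * (almostPeriods v (1 / 10)).card ≤ 5 * (almostPeriods u (1 / 20)).card := by
  classical
  set S := almostPeriods u (1 / 20) with hS
  set T := almostPeriods v (1 / 10) with hT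
  set g : H → ℝ := fun t => if t ∈ S then 1 else 0 with hg
  have hg0 : ∀ t, 0 ≤ g t := fun t => by simp only [hg]; split_ifs <;> norm_num
  have hg1 : ∀ t, g t ≤ 1 := fun t => by simp only [hg]; split_ifs <;> norm_num
  have h9 : 9 / 10 ≤ ∑ y, ∑ z, v y * v z * g (y - z) := le_sum_mul_ite u v hv hv1 h
  have ht : ∀ t ∈ T, 8 / 10 ≤ ∑ y, ∑ z, v y * v z * g (y - z + t) := by
    intro t htT
    have e : ∑ y, ∑ z, v y * v z * g (y - z + t) = ∑ y, ∑ z, v (y - t) * v z * g (y - z) := by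
      rw [← Equiv.sum_comp (Equiv.subRight t)]
      refine Finset.sum_congr rfl fun y _ => Finset.sum_congr rfl fun z _ => ?_
      simp only [Equiv.subRight_apply]
      congr 2
      abel
    have hb : ∑ y, ∑ z, (v y * v z * g (y - z) - v (y - t) * v z * g (y - z)) ≤
        ∑ y, ∑ z, |v y - v (y - t)| * v z := by
      refine Finset.sum_le_sum fun y _ => Finset.sum_le_sum fun z _ => ?_
      calc v y * v z * g (y - z) - v (y - t) * v z * g (y - z)
          = (v y - v (y - t)) * (v z * g (y - z)) := by ring
        _ ≤ |v y - v (y - t)| * (v z * g (y - z)) :=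
          mul_le_mul_of_nonneg_right (le_abs_self _) (mul_nonneg (hv z) (hg0 _))
        _ ≤ _ := mul_le_mul_of_nonneg_left
          (mul_le_of_le_one_right (hv z) (hg1 _)) (abs_nonneg _)
    rw [← Finset.sum_mul_sum, hv1, mul_one] at hb
    simp only [Finset.sum_sub_distrib] at hb
    have := mem_almostPeriods.1 htT
    rw [tv] at this
    rw [e]
    linarith
  have hs := Finset.sum_le_sum ht
  have hswap : ∑ t ∈ T, ∑ y, ∑ z, v y * v z * g (y - z + t) ≤ S.card := by
    rw [Finset.sum_comm]
    calc ∑ y, ∑ t ∈ T, ∑ z, v y * v z * g (y - z + t)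
        ≤ ∑ y, ∑ z, v y * v z * S.card := by
          refine Finset.sum_le_sum fun y _ => ?_
          rw [Finset.sum_comm]
          refine Finset.sum_le_sum fun z _ => ?_
          rw [← Finset.mul_sum]
          refine mul_le_mul_of_nonneg_left ?_ (mul_nonneg (hv y) (hv z))
          calc ∑ t ∈ T, g (y - z + t) ≤ ∑ t, g (y - z + t) :=
                Finset.sum_le_sum_of_subset_of_nonneg (Finset.subset_univ _) fun t _ _ => hg0 _
            _ = ∑ t, g t := Equiv.sum_comp (Equiv.addLeft (y - z)) g
            _ = S.card := by simp [hg]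
      _ = S.card := by
        simp only [← Finset.sum_mul]
        rw [← Finset.sum_mul_sum, hv1]; ring
  rw [Finset.sum_const, nsmul_eq_mul] at hs
  have : (4 * T.card : ℝ) ≤ 5 * S.card := by linarith
  exact_mod_cast this

lemma min_card_le_card_almostPeriods {q : ℕ} (hq : q.Prime) (hcard : Fintype.card H = q)
    (u : H → ℝ) :
    min q (2 * (almostPeriods u (1 / 20)).card - 1) ≤ (almostPeriods u (1 / 10)).card := by
  classical
  set S := almostPeriods u (1 / 20) with hS
  have h0 : S.Nonempty := ⟨0, mem_almostPeriods.2 (by rw [tv_zero]; norm_num)⟩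
  have hsub : S + S ⊆ almostPeriods u (1 / 10) := by
    intro t ht
    obtain ⟨a, ha, b, hb, rfl⟩ := Finset.mem_add.1 ht
    rw [hS, mem_almostPeriods] at ha hb
    rw [mem_almostPeriods]
    linarith [tv_add_le u a b]
  refine le_trans ?_ (Finset.card_le_card hsub)
  have hcd := cauchy_davenport_minOrder_add h0 h0
  have hmin : (q : ℕ∞) ≤ AddMonoid.minOrder H := by
    rw [AddMonoid.le_minOrder]
    intro a ha _
    have hd := addOrderOf_dvd_card (x := a)
    rw [hcard] at hd
    rcases (Nat.dvd_prime hq).1 hd with h | h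
    · exact absurd (AddMonoid.addOrderOf_eq_one_iff.1 h) ha
    · rw [h]
  have : ((min q (2 * S.card - 1) : ℕ) : ℕ∞) ≤ ((S + S).card : ℕ∞) := by
    refine le_trans ?_ hcd
    refine le_min (le_trans (Nat.cast_le.2 (min_le_left _ _)) hmin) (Nat.cast_le.2 ?_)
    rw [← two_mul]
    exact min_le_right _ _
  exact_mod_cast this

end Translates

section Gain

variable {H : Type*} [AddCommGroup H] [Fintype H]

lemma mul_log_card_sub_one_le_deficit (v : H → ℝ) (hv : ∀ x, 0 ≤ v x) (hv1 : ∑ x, v x = 1)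
    (x₀ : H) : v x₀ * Real.log (Fintype.card H) - 1 ≤ deficit v := by
  classical
  set q : ℝ := ((Fintype.card H : ℕ) : ℝ) with hq
  have hq0 : 0 < q := by rw [hq]; exact_mod_cast Fintype.card_pos_iff.2 ⟨x₀⟩
  have h0 : v x₀ - 1 ≤ v x₀ * Real.log (v x₀) := by
    have := sub_le_mul_log_sub (hv x₀) zero_le_one (by norm_num)
    simpa using this
  have h1 : ∀ x, v x - 1 / q ≤ v x * Real.log (v x) + v x * Real.log q := by
    intro x
    have := sub_le_mul_log_sub (hv x) (b := 1 / q) (by positivity)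
      (fun h => absurd h (by positivity))
    rw [Real.log_div one_ne_zero hq0.ne', Real.log_one] at this
    linarith
  have hs := Finset.sum_le_sum fun (x : H) (_ : x ∈ Finset.univ.erase x₀) => h1 x
  have e1 := Finset.add_sum_erase Finset.univ (fun x => v x * Real.log (v x) + v x * Real.log q)
    (Finset.mem_univ x₀)
  have e2 := Finset.add_sum_erase Finset.univ (fun x => v x - 1 / q) (Finset.mem_univ x₀)
  have e3 : ∑ x, (v x - 1 / q) = 0 := by
    rw [Finset.sum_sub_distrib, hv1, Finset.sum_const, Finset.card_univ, nsmul_eq_mul, ← hq]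
    field_simp
    norm_num
  have e4 : ∑ x, (v x * Real.log (v x) + v x * Real.log q) =
      ∑ x, v x * Real.log (v x) + Real.log q := by
    rw [Finset.sum_add_distrib, ← Finset.sum_mul, hv1, one_mul]
  have hq1 : 0 ≤ 1 / q := by positivity
  unfold deficit
  rw [hv1, Real.log_one, ← hq]
  linarith

lemma deficit_dconv_le_half_of_card (u v : H → ℝ) (hu : ∀ x, 0 ≤ u x) (hv : ∀ x, 0 ≤ v x)
    (hu1 : ∑ x, u x = 1) (hvs : ∑ x, v x = 1)
    (h : Fintype.card H ≤ (almostPeriods v (1 / 10)).card) :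
    deficit (dconv u v) ≤ 1 / 2 * deficit u := by
  refine deficit_dconv_le_half u v hu hv hu1 hvs fun t => ?_
  have : almostPeriods v (1 / 10) = Finset.univ :=
    Finset.eq_univ_of_card _ (le_antisymm (Finset.card_le_univ _) h)
  have ht : t ∈ almostPeriods v (1 / 10) := this ▸ Finset.mem_univ t
  have := mem_almostPeriods.1 ht
  rw [tv] at this
  linarith

lemma exists_le_apply_of_card_almostPeriods_le_one (u v : H → ℝ) (hv : ∀ x, 0 ≤ v x)
    (hv1 : ∑ x, v x = 1) (h : ∑ y, ∑ z, v y * v z * tv u (y - z) ≤ 1 / 200)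
    (hc : (almostPeriods u (1 / 20)).card ≤ 1) : ∃ x, 9 / 10 ≤ v x := by
  classical
  have h9 := le_sum_mul_ite u v hv hv1 h
  have hz : (0 : H) ∈ almostPeriods u (1 / 20) :=
    mem_almostPeriods.2 (by rw [tv_zero]; norm_num)
  have hmem : ∀ t, t ∈ almostPeriods u (1 / 20) ↔ t = 0 := fun t =>
    ⟨fun ht => Finset.card_le_one.1 hc t ht 0 hz, fun ht => ht ▸ hz⟩
  simp only [hmem, sub_eq_zero, mul_ite, mul_one, mul_zero, Finset.sum_ite_eq, Finset.mem_univ,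
    if_true] at h9
  by_contra! hlt
  obtain ⟨x₀, hx₀⟩ : ∃ x, v x ≠ 0 := by
    by_contra! h0
    simp [h0] at hv1
  have : ∑ y, v y * v y < ∑ y, v y * (9 / 10) :=
    Finset.sum_lt_sum (fun y _ => mul_le_mul_of_nonneg_left (hlt y).le (hv y))
      ⟨x₀, Finset.mem_univ _, mul_lt_mul_of_pos_left (hlt x₀) ((hv x₀).lt_of_ne hx₀.symm)⟩
  rw [← Finset.sum_mul, hv1] at this
  linarith

lemma min_le_half_add_sub_deficit_dconv {q : ℕ} (hq : q.Prime) (hcard : Fintype.card H = q)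
    {Λ : ℝ} (hΛ : 0 ≤ Λ) (hlog : 4 * Λ + 4 ≤ Real.log q) (u v : H → ℝ) (hu : ∀ x, 0 ≤ u x)
    (hv : ∀ x, 0 ≤ v x) (hu1 : ∑ x, u x = 1) (hv1 : ∑ x, v x = 1) (hd : deficit u ≤ 2 * Λ)
    (he : deficit v ≤ 2 * Λ) :
    min (1 / 1280000) ((deficit u + deficit v) / 6) ≤
      (deficit u + deficit v) / 2 - deficit (dconv u v) := by
  by_contra! hlt
  rw [lt_min_iff] at hlt
  obtain ⟨hc, h6⟩ := hlt
  have hD1 := deficit_dconv_le u v hu hv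
  have hD2 := deficit_dconv_le' u v hu hv
  rw [hv1, one_mul] at hD1
  rw [hu1, one_mul] at hD2
  have hMU : ∑ y, ∑ z, v y * v z * tv u (y - z) ≤ 1 / 200 := by
    refine abs_le_of_sq_le_sq' ?_ (by norm_num) |>.2
    have := sq_sum_mul_tv_le u v hu hv hu1 hv1
    linarith
  have hMV : ∑ y, ∑ z, u y * u z * tv v (y - z) ≤ 1 / 200 := by
    refine abs_le_of_sq_le_sq' ?_ (by norm_num) |>.2
    have := sq_sum_mul_tv_le v u hv hu hv1 hu1
    rw [dconv_comm] at this
    linarith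
  have hcU := card_almostPeriods_le u v hv hv1 hMU
  have hcV := card_almostPeriods_le v u hu hu1 hMV
  have hmU := min_card_le_card_almostPeriods hq hcard u
  have hmV := min_card_le_card_almostPeriods hq hcard v
  have hnV : (almostPeriods v (1 / 10)).card < q := by
    by_contra! h
    have := deficit_dconv_le_half_of_card u v hu hv hu1 hv1 (hcard ▸ h)
    linarith
  have hnU : (almostPeriods u (1 / 10)).card < q := by
    by_contra! h
    have := deficit_dconv_le_half_of_card v u hv hu hv1 hu1 (hcard ▸ h)
    rw [dconv_comm] at this
    linarith
  have hone : (almostPeriods u (1 / 20)).card ≤ 1 := by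
    have hposV : 0 < (almostPeriods v (1 / 20)).card := Finset.card_pos.2
      ⟨0, mem_almostPeriods.2 (by rw [tv_zero]; norm_num)⟩
    omega
  obtain ⟨x, hx⟩ := exists_le_apply_of_card_almostPeriods_le_one u v hv hv1 hMU hone
  have := mul_log_card_sub_one_le_deficit v hv hv1 x
  rw [hcard] at this
  nlinarith

lemma deficit_dconv_le_sub_of_sum_eq_one {q : ℕ} (hq : q.Prime) (hcard : Fintype.card H = q)
    {Λ : ℝ} (hΛ : 1 ≤ Λ) (hlog : 4 * Λ + 4 ≤ Real.log q) (u v : H → ℝ) (hu : ∀ x, 0 ≤ u x)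
    (hv : ∀ x, 0 ≤ v x) (hu1 : ∑ x, u x = 1) (hv1 : ∑ x, v x = 1) :
    deficit (dconv u v) ≤ (deficit u + deficit v) / 2 - 1 / 5120000 / Λ *
      (deficit u + deficit v - 2 * deficit u * deficit v / Λ) := by
  have hD1 := deficit_dconv_le u v hu hv
  have hD2 := deficit_dconv_le' u v hu hv
  rw [hv1, one_mul] at hD1
  rw [hu1, one_mul] at hD2
  have hd0 := deficit_nonneg u hu
  have he0 := deficit_nonneg v hv
  have hb := min_le_half_add_sub_deficit_dconv hq hcard (by linarith : 0 ≤ Λ) hlog u v hu hv hu1 hv1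
  set d := deficit u
  set e := deficit v
  set D := deficit (dconv u v)
  have hΛ0 : 0 < Λ := by linarith
  set κ : ℝ := 1 / 5120000 / Λ with hκ
  have hκ0 : 0 < κ := by positivity
  have hκΛ : κ * Λ = 1 / 5120000 := by rw [hκ]; field_simp
  have hκ1 : κ ≤ 1 / 5120000 := by nlinarith
  have hquo : 0 ≤ 2 * d * e / Λ := by positivity
  have hde0 : 0 ≤ d + e := by linarith
  have hk1 : κ * (d + e - 2 * d * e / Λ) ≤ κ * (d + e) :=
    mul_le_mul_of_nonneg_left (by linarith) hκ0.le
  have hk2 : κ * (d + e) ≤ (d + e) / 6 := by nlinarith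
  by_cases hbig : d ≤ 2 * Λ ∧ e ≤ 2 * Λ
  · have hk3 : κ * (d + e) ≤ 1 / 1280000 := by nlinarith [hbig.1, hbig.2]
    have := le_trans (le_min hk3 hk2) (hb hbig.1 hbig.2)
    linarith
  by_cases hdΛ : d ≤ Λ
  · have : 2 * Λ < e := by
      by_contra! h
      exact hbig ⟨by linarith, h⟩
    linarith
  by_cases heΛ : e ≤ Λ
  · have : 2 * Λ < d := by
      by_contra! h
      exact hbig ⟨h, by linarith⟩
    linarith
  push Not at hdΛ heΛ
  have : d + e ≤ 2 * d * e / Λ := by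
    rw [le_div_iff₀ hΛ0]
    nlinarith [mul_le_mul_of_nonneg_left heΛ.le hd0, mul_le_mul_of_nonneg_left hdΛ.le he0]
  have : κ * (d + e - 2 * d * e / Λ) ≤ 0 :=
    mul_nonpos_of_nonneg_of_nonpos hκ0.le (by linarith)
  linarith

lemma dconv_const_mul (a b : ℝ) (u v : H → ℝ) :
    dconv (fun x => a * u x) (fun x => b * v x) = fun x => a * b * dconv u v x := by
  funext x
  simp only [dconv, Finset.mul_sum]
  exact Finset.sum_congr rfl fun _ _ => by ring

/-- Improvement over the trivial bound for the entropy deficit of a convolution on a group of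
large prime order. -/
lemma deficit_dconv_le_sub {q : ℕ} (hq : q.Prime) (hcard : Fintype.card H = q)
    {Λ : ℝ} (hΛ : 1 ≤ Λ) (hlog : 4 * Λ + 4 ≤ Real.log q) (u v : H → ℝ) (hu : ∀ x, 0 ≤ u x)
    (hv : ∀ x, 0 ≤ v x) :
    deficit (dconv u v) ≤ ((∑ x, v x) * deficit u + (∑ x, u x) * deficit v) / 2 -
      1 / 5120000 / Λ * ((∑ x, v x) * deficit u + (∑ x, u x) * deficit v
        - 2 * deficit u * deficit v / Λ) := by
  have hzero : ∀ w : H → ℝ, (∀ x, 0 ≤ w x) → ∑ x, w x = 0 → w = fun _ => 0 := by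
    intro w hw h
    funext x
    exact (Finset.sum_eq_zero_iff_of_nonneg fun x _ => hw x).1 h x (Finset.mem_univ x)
  set m := ∑ x, u x with hm
  set m' := ∑ x, v x with hm'
  have hm0 : 0 ≤ m := Finset.sum_nonneg fun x _ => hu x
  have hm0' : 0 ≤ m' := Finset.sum_nonneg fun x _ => hv x
  rcases hm0.eq_or_lt with h0 | h0
  · rw [← h0, hzero u hu h0.symm]
    have : dconv (fun _ => 0) v = fun _ : H => (0 : ℝ) := by funext x; simp [dconv]
    simp [this, deficit_zero]
  rcases hm0'.eq_or_lt with h0' | h0'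
  · rw [← h0', hzero v hv h0'.symm]
    have : dconv u (fun _ => 0) = fun _ : H => (0 : ℝ) := by funext x; simp [dconv]
    simp [this, deficit_zero]
  have hmain := deficit_dconv_le_sub_of_sum_eq_one hq hcard hΛ hlog (fun x => m⁻¹ * u x)
    (fun x => m'⁻¹ * v x) (fun x => mul_nonneg (by positivity) (hu x))
    (fun x => mul_nonneg (by positivity) (hv x))
    (by rw [← Finset.mul_sum, ← hm, inv_mul_cancel₀ h0.ne'])
    (by rw [← Finset.mul_sum, ← hm', inv_mul_cancel₀ h0'.ne'])
  rw [dconv_const_mul, deficit_const_mul (by positivity) _ hu,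
    deficit_const_mul (by positivity) _ hv, deficit_const_mul (by positivity) _ (dconv_nonneg hu hv)] at hmain
  have := mul_le_mul_of_nonneg_left hmain (mul_nonneg hm0 hm0')
  have e1 : m * m' * (m⁻¹ * m'⁻¹ * deficit (dconv u v)) = deficit (dconv u v) := by
    field_simp
  rw [e1] at this
  refine this.trans_eq ?_
  field_simp

end Gain

section Fibres

variable {G : Type*} [AddCommGroup G] [Fintype G]

open Classical in
/-- Pushforward of a density along an endomorphism. -/
noncomputable def push (φ : G →+ G) (f : G → ℝ) : G → ℝ := fun y => ∑ x, if φ x = y then f x else 0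

/-- The sum `∑ f log f`, that is, minus the Shannon entropy. -/
noncomputable def negEntropy (f : G → ℝ) : ℝ := ∑ x, f x * Real.log (f x)

lemma push_nonneg (φ : G →+ G) {f : G → ℝ} (hf : ∀ x, 0 ≤ f x) (y : G) : 0 ≤ push φ f y :=
  Finset.sum_nonneg fun x _ => by split_ifs <;> simp [hf]

lemma sum_push_mul (φ : G →+ G) (f k : G → ℝ) : ∑ y, push φ f y * k y = ∑ x, f x * k (φ x) := by
  simp only [push, Finset.sum_mul]
  rw [Finset.sum_comm]
  refine Finset.sum_congr rfl fun x _ => ?_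
  rw [Finset.sum_eq_single (φ x)] <;> simp +contextual [eq_comm]

lemma sum_push (φ : G →+ G) (f : G → ℝ) : ∑ y, push φ f y = ∑ x, f x := by
  simpa using sum_push_mul φ f fun _ => 1

lemma push_dconv (φ : G →+ G) (f g : G → ℝ) :
    push φ (dconv f g) = dconv (push φ f) (push φ g) := by
  funext w
  have h := sum_push_mul φ f fun y => push φ g (w - y)
  rw [dconv, h]
  have h1 : ∀ x, push φ (fun t => g (t - x)) w = push φ g (w - φ x) := by
    intro x
    unfold push
    rw [← Equiv.sum_comp (Equiv.addRight x)]
    refine Finset.sum_congr rfl fun t _ => ?_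
    have : φ (t + x) = w ↔ φ t = w - φ x := by rw [map_add, eq_sub_iff_add_eq]
    simp only [Equiv.coe_addRight, add_sub_cancel_right]
    congr 1
    exact propext this
  rw [Finset.sum_congr rfl fun x _ => by rw [← h1]]
  simp only [push, dconv, Finset.mul_sum]
  rw [Finset.sum_comm]
  refine Finset.sum_congr rfl fun t _ => ?_
  split_ifs <;> simp

variable (φ : G →+ G) [Fintype φ.ker]

/-- The restriction of `f` to the coset `x + ker φ`. -/
def fibre (f : G → ℝ) (x : G) : φ.ker → ℝ := fun h => f (x + h)

lemma sum_fibre (f : G → ℝ) (x : G) : ∑ h, fibre φ f x h = push φ f (φ x) := by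
  classical
  unfold push fibre
  rw [← Finset.sum_filter]
  refine Finset.sum_bij' (fun h _ => x + h) (fun y hy => ⟨y - x, ?_⟩) ?_ ?_ ?_ ?_ ?_
  · rw [Finset.mem_filter] at hy
    rw [AddMonoidHom.mem_ker, map_sub, hy.2, sub_self]
  · intro h _
    have := h.2
    rw [AddMonoidHom.mem_ker] at this
    simp [this]
  · simp
  · simp
  · simp
  · simp

lemma sum_sum_fibre (f : G → ℝ) :
    ∑ x, ∑ h, fibre φ f x h = Fintype.card φ.ker * ∑ x, f x := by
  unfold fibre
  rw [Finset.sum_comm]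
  have : ∀ h : φ.ker, ∑ x, f (x + h) = ∑ x, f x := fun h =>
    Equiv.sum_comp (Equiv.addRight (h : G)) f
  simp [this]

/-- Average over cosets of `ker φ` of the entropy deficit of the restriction. -/
noncomputable def fibreDeficit (f : G → ℝ) : ℝ :=
  (∑ x, deficit (fibre φ f x)) / Fintype.card φ.ker

lemma fibreDeficit_eq (f : G → ℝ) (hf1 : ∑ x, f x = 1) :
    fibreDeficit φ f =
      negEntropy f - negEntropy (push φ f) + Real.log (Fintype.card φ.ker) := by
  have hq : (0 : ℝ) < Fintype.card φ.ker := by exact_mod_cast Fintype.card_pos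
  unfold fibreDeficit deficit
  rw [Finset.sum_add_distrib, Finset.sum_sub_distrib, ← Finset.sum_mul, sum_sum_fibre, hf1]
  have h1 : ∑ x, ∑ h, fibre φ f x h * Real.log (fibre φ f x h) =
      Fintype.card φ.ker * negEntropy f :=
    sum_sum_fibre φ fun x => f x * Real.log (f x)
  have h2 : ∑ x, (∑ h, fibre φ f x h) * Real.log (∑ h, fibre φ f x h) =
      Fintype.card φ.ker * negEntropy (push φ f) := by
    rw [negEntropy, sum_push_mul φ f fun y => Real.log (push φ f y), ← sum_sum_fibre]
    refine Finset.sum_congr rfl fun x _ => ?_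
    rw [Finset.sum_mul]
    refine Finset.sum_congr rfl fun h _ => ?_
    have := h.2
    rw [AddMonoidHom.mem_ker] at this
    rw [sum_fibre]
    simp [fibre, this]
  rw [h1, h2]
  field_simp

lemma fibreDeficit_nonneg (f : G → ℝ) (hf : ∀ x, 0 ≤ f x) : 0 ≤ fibreDeficit φ f :=
  div_nonneg (Finset.sum_nonneg fun _ _ => deficit_nonneg _ fun _ => hf _) (Nat.cast_nonneg _)

lemma fibre_dconv (f g : G → ℝ) (z : G) :
    fibre φ (dconv f g) z = fun k => ∑ x, (1 / (Fintype.card φ.ker : ℝ)) *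
      dconv (fibre φ f x) (fibre φ g (z - x)) k := by
  have hq : (0 : ℝ) < Fintype.card φ.ker := by exact_mod_cast Fintype.card_pos
  funext k
  rw [← Finset.mul_sum]
  have h1 : ∑ x, dconv (fibre φ f x) (fibre φ g (z - x)) k =
      ∑ x, ∑ h, fibre φ (fun y => f y * g (z + k - y)) x h := by
    refine Finset.sum_congr rfl fun x _ => ?_
    unfold dconv fibre
    refine Finset.sum_congr rfl fun h _ => ?_
    congr 2
    push_cast
    abel
  rw [h1, sum_sum_fibre]
  unfold fibre dconv
  field_simp

lemma fibreDeficit_dconv_le_of_forall (f g : G → ℝ) (hf : ∀ x, 0 ≤ f x) (hg : ∀ x, 0 ≤ g x)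
    (B : G → G → ℝ) (hB : ∀ x y, deficit (dconv (fibre φ f x) (fibre φ g y)) ≤ B x y) :
    fibreDeficit φ (dconv f g) ≤ (∑ x, ∑ y, B x y) / (Fintype.card φ.ker : ℝ) ^ 2 := by
  have hq : (0 : ℝ) < Fintype.card φ.ker := by exact_mod_cast Fintype.card_pos
  unfold fibreDeficit
  rw [div_le_div_iff₀ hq (by positivity)]
  have h1 : ∀ z, deficit (fibre φ (dconv f g) z) ≤
      (1 / (Fintype.card φ.ker : ℝ)) * ∑ x, B x (z - x) := by
    intro z
    rw [fibre_dconv, Finset.mul_sum]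
    refine (deficit_sum_le _ (fun _ => by positivity) _ fun x k => dconv_nonneg
      (fun h => hf _) (fun h => hg _) k).trans ?_
    exact Finset.sum_le_sum fun x _ => mul_le_mul_of_nonneg_left (hB _ _) (by positivity)
  have h2 := Finset.sum_le_sum fun (z : G) (_ : z ∈ Finset.univ) => h1 z
  rw [← Finset.mul_sum, Finset.sum_comm] at h2
  have h3 : ∑ x, ∑ z, B x (z - x) = ∑ x, ∑ y, B x y :=
    Finset.sum_congr rfl fun x _ => Equiv.sum_comp (Equiv.subRight x) (B x)
  rw [h3] at h2
  have := mul_le_mul_of_nonneg_right h2 (sq_nonneg (Fintype.card φ.ker : ℝ))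
  refine this.trans_eq ?_
  field_simp

lemma sum_deficit_fibre (f : G → ℝ) :
    ∑ x, deficit (fibre φ f x) = Fintype.card φ.ker * fibreDeficit φ f := by
  have hq : (0 : ℝ) < Fintype.card φ.ker := by exact_mod_cast Fintype.card_pos
  unfold fibreDeficit
  field_simp

lemma fibreDeficit_dconv_le_left (f g : G → ℝ) (hf : ∀ x, 0 ≤ f x) (hg : ∀ x, 0 ≤ g x)
    (hg1 : ∑ x, g x = 1) : fibreDeficit φ (dconv f g) ≤ fibreDeficit φ f := by
  have hq : (0 : ℝ) < Fintype.card φ.ker := by exact_mod_cast Fintype.card_pos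
  refine (fibreDeficit_dconv_le_of_forall φ f g hf hg _ fun x y =>
    deficit_dconv_le (fibre φ f x) (fibre φ g y) (fun _ => hf _) fun _ => hg _).trans_eq ?_
  simp only [← Finset.sum_mul]
  rw [← Finset.mul_sum, sum_sum_fibre, hg1, sum_deficit_fibre]
  field_simp

lemma fibreDeficit_dconv_le_right (f g : G → ℝ) (hf : ∀ x, 0 ≤ f x) (hg : ∀ x, 0 ≤ g x)
    (hf1 : ∑ x, f x = 1) : fibreDeficit φ (dconv f g) ≤ fibreDeficit φ g := by
  rw [dconv_comm]; exact fibreDeficit_dconv_le_left φ g f hg hf hf1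

lemma fibreDeficit_dconv_le_sub {q : ℕ} (hq : q.Prime) (hcard : Fintype.card φ.ker = q)
    {Λ : ℝ} (hΛ : 1 ≤ Λ) (hlog : 4 * Λ + 4 ≤ Real.log q) (f g : G → ℝ) (hf : ∀ x, 0 ≤ f x)
    (hg : ∀ x, 0 ≤ g x) (hf1 : ∑ x, f x = 1) (hg1 : ∑ x, g x = 1) :
    fibreDeficit φ (dconv f g) ≤ (fibreDeficit φ f + fibreDeficit φ g) / 2 -
      1 / 5120000 / Λ * (fibreDeficit φ f + fibreDeficit φ g
        - 2 * fibreDeficit φ f * fibreDeficit φ g / Λ) := by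
  have hq0 : (0 : ℝ) < Fintype.card φ.ker := by exact_mod_cast Fintype.card_pos
  refine (fibreDeficit_dconv_le_of_forall φ f g hf hg _ fun x y =>
    deficit_dconv_le_sub hq hcard hΛ hlog (fibre φ f x) (fibre φ g y) (fun _ => hf _)
      fun _ => hg _).trans_eq ?_
  set κ : ℝ := 1 / 5120000 / Λ
  set a : G → ℝ := fun x => ∑ h, fibre φ f x h with ha
  set b : G → ℝ := fun x => ∑ h, fibre φ g x h with hb
  set d : G → ℝ := fun x => deficit (fibre φ f x) with hd
  set e : G → ℝ := fun x => deficit (fibre φ g x) with he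
  have sa : ∑ x, a x = Fintype.card φ.ker := by rw [ha, sum_sum_fibre, hf1, mul_one]
  have sb : ∑ x, b x = Fintype.card φ.ker := by rw [hb, sum_sum_fibre, hg1, mul_one]
  have sd : ∑ x, d x = Fintype.card φ.ker * fibreDeficit φ f := sum_deficit_fibre φ f
  have se : ∑ x, e x = Fintype.card φ.ker * fibreDeficit φ g := sum_deficit_fibre φ g
  have h1 : ∀ x y, (b y * d x + a x * e y) / 2 - κ * (b y * d x + a x * e y - 2 * d x * e y / Λ) =
      (1 / 2 - κ) * (d x * b y) + (1 / 2 - κ) * (a x * e y) + 2 * κ / Λ * (d x * e y) :=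
    fun x y => by ring
  have h2 : ∑ x, ∑ y, ((b y * d x + a x * e y) / 2 -
      κ * (b y * d x + a x * e y - 2 * d x * e y / Λ)) =
      (1 / 2 - κ) * ((∑ x, d x) * ∑ y, b y) + (1 / 2 - κ) * ((∑ x, a x) * ∑ y, e y) +
        2 * κ / Λ * ((∑ x, d x) * ∑ y, e y) := by
    simp only [h1, Finset.sum_add_distrib, ← Finset.mul_sum, Finset.sum_mul_sum]
  rw [h2, sa, sb, sd, se]
  have hΛ0 : Λ ≠ 0 := by positivity
  field_simp
  ring

end Fibres

lemma sum_range_le_of_gain {d D : ℕ → ℝ} {m : ℕ} {L : ℝ} (hL : 0 ≤ L) (hd : ∀ i, 0 ≤ d i)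
    (hD : ∀ i, D i ≤ d i) (hD' : ∀ i, D i ≤ d (i + 1))
    (hgain : ∀ i, D i ≤ (d i + d (i + 1)) / 2 - 1 / 5120000 / (2 * (L + 1)) *
      (d i + d (i + 1) - 2 * d i * d (i + 1) / (2 * (L + 1))))
    (hsum : ∑ i ∈ Finset.range (m + 1), d i - ∑ i ∈ Finset.range (m + 1), D i ≤ L)
    (hm : d m ≤ 1) : ∑ i ∈ Finset.range (m + 1), d i ≤ 20480001 * (L + 1) ^ 2 := by
  rw [Finset.sum_range_succ, Finset.sum_range_succ] at hsum
  have hsum' : ∑ i ∈ Finset.range m, (d i - D i) ≤ L := by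
    rw [Finset.sum_sub_distrib]; linarith [hD m]
  have hbound : ∀ i ≤ m, d i ≤ L + 1 := by
    intro j hj
    have h1 : d j - d m ≤ ∑ i ∈ Finset.Ico j m, (d i - D i) := by
      have h := Finset.sum_Ico_sub d hj
      have : ∑ i ∈ Finset.Ico j m, -(d (i + 1) - d i) ≤ ∑ i ∈ Finset.Ico j m, (d i - D i) :=
        Finset.sum_le_sum fun i _ => by linarith [hD' i]
      rw [Finset.sum_neg_distrib, h] at this
      linarith
    have h2 : ∑ i ∈ Finset.Ico j m, (d i - D i) ≤ ∑ i ∈ Finset.range m, (d i - D i) := by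
      rw [Finset.range_eq_Ico]
      exact Finset.sum_le_sum_of_subset_of_nonneg (Finset.Ico_subset_Ico_left (Nat.zero_le _))
        fun i _ _ => by linarith [hD i]
    linarith
  set κ : ℝ := 1 / 5120000 / (2 * (L + 1)) with hκ
  have hκ0 : 0 < κ := by positivity
  have hstep : ∀ i ∈ Finset.range m, (d i - d (i + 1)) / 2 + κ / 2 * d i ≤ d i - D i := by
    intro i hi
    rw [Finset.mem_range] at hi
    have b1 := hbound i hi.le
    have b2 := hbound (i + 1) hi
    have : 2 * d i * d (i + 1) / (2 * (L + 1)) ≤ (d i + d (i + 1)) / 2 := by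
      rw [div_le_iff₀ (by positivity)]
      nlinarith [mul_le_mul_of_nonneg_left b2 (hd i), mul_le_mul_of_nonneg_left b1 (hd (i + 1))]
    have h1 : κ * ((d i + d (i + 1)) / 2) ≤
        κ * (d i + d (i + 1) - 2 * d i * d (i + 1) / (2 * (L + 1))) :=
      mul_le_mul_of_nonneg_left (by linarith) hκ0.le
    have h2 : 0 ≤ κ * d (i + 1) := mul_nonneg hκ0.le (hd _)
    have := hgain i
    linarith
  have hs := Finset.sum_le_sum hstep
  rw [Finset.sum_add_distrib, ← Finset.mul_sum, ← Finset.sum_div, Finset.sum_range_sub'] at hs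
  have hfin : κ / 2 * ∑ i ∈ Finset.range m, d i ≤ L + 1 := by linarith [hd 0]
  have hmul : ∑ i ∈ Finset.range m, d i ≤ 20480000 * (L + 1) ^ 2 := by
    have hk : κ * (2 * (L + 1)) = 1 / 5120000 := by rw [hκ]; field_simp
    have h3 := mul_le_mul_of_nonneg_left hfin (by positivity : 0 ≤ 20480000 * (L + 1))
    have e : 20480000 * (L + 1) * (κ / 2 * ∑ i ∈ Finset.range m, d i) =
        κ * (2 * (L + 1)) * (5120000 * ∑ i ∈ Finset.range m, d i) := by ring
    rw [e, hk] at h3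
    linarith
  rw [Finset.sum_range_succ]
  nlinarith

section Chain

variable {G : Type*} [AddCommGroup G] [Fintype G]

lemma iterate_push_nonneg (φ : G →+ G) {f : G → ℝ} (hf : ∀ x, 0 ≤ f x) (i : ℕ) (x : G) :
    0 ≤ (push φ)^[i] f x := by
  induction i generalizing x with
  | zero => exact hf x
  | succ i ih => rw [Function.iterate_succ_apply']; exact push_nonneg φ ih x

lemma sum_iterate_push (φ : G →+ G) (f : G → ℝ) (i : ℕ) :
    ∑ x, (push φ)^[i] f x = ∑ x, f x := by
  induction i with
  | zero => rfl
  | succ i ih => rw [Function.iterate_succ_apply', sum_push, ih]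

lemma iterate_push_dconv (φ : G →+ G) (f g : G → ℝ) (i : ℕ) :
    (push φ)^[i] (dconv f g) = dconv ((push φ)^[i] f) ((push φ)^[i] g) := by
  induction i with
  | zero => rfl
  | succ i ih => simp only [Function.iterate_succ_apply', ih, push_dconv]

lemma deficit_eq_negEntropy {X : Type*} [Fintype X] (f : X → ℝ) (hf1 : ∑ x, f x = 1) :
    deficit f = negEntropy f + Real.log (Fintype.card X) := by
  simp [deficit, negEntropy, hf1]

lemma negEntropy_dconv_le (f g : G → ℝ) (hf : ∀ x, 0 ≤ f x) (hg : ∀ x, 0 ≤ g x)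
    (hf1 : ∑ x, f x = 1) (hg1 : ∑ x, g x = 1) : negEntropy (dconv f g) ≤ negEntropy f := by
  have h := deficit_dconv_le f g hf hg
  rw [hg1, one_mul, deficit_eq_negEntropy _ hf1,
    deficit_eq_negEntropy _ (by rw [sum_dconv, hf1, hg1, one_mul])] at h
  linarith

lemma sum_fibreDeficit_iterate_push (φ : G →+ G) [Fintype φ.ker] (f : G → ℝ)
    (hf1 : ∑ x, f x = 1) (n : ℕ) :
    ∑ i ∈ Finset.range n, fibreDeficit φ ((push φ)^[i] f) =
      negEntropy f - negEntropy ((push φ)^[n] f) + n * Real.log (Fintype.card φ.ker) := by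
  induction n with
  | zero => simp
  | succ n ih =>
    rw [Finset.sum_range_succ, ih, fibreDeficit_eq φ _ (by rw [sum_iterate_push, hf1]),
      Function.iterate_succ_apply']
    push_cast
    ring

lemma negEntropy_le_of_gain (φ : G →+ G) [Fintype φ.ker] {q : ℕ} (hq : q.Prime)
    (hcard : Fintype.card φ.ker = q) {L : ℝ} (hL : 0 ≤ L) (hlog : 8 * (L + 1) + 4 ≤ Real.log q)
    (f : G → ℝ) (hf : ∀ x, 0 ≤ f x) (hf1 : ∑ x, f x = 1)
    (hfL : negEntropy f - negEntropy (dconv f (push φ f)) ≤ L) (m : ℕ)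
    (hm : fibreDeficit φ ((push φ)^[m] f) ≤ 1) :
    negEntropy f - negEntropy ((push φ)^[m + 1] f) + (m + 1) * Real.log q ≤
      20480001 * (L + 1) ^ 2 := by
  have h0 := iterate_push_nonneg φ hf
  have h1 : ∀ i, ∑ x, (push φ)^[i] f x = 1 := fun i => by rw [sum_iterate_push, hf1]
  have hg : ∀ i, (push φ)^[i] (dconv f (push φ f)) =
      dconv ((push φ)^[i] f) ((push φ)^[i + 1] f) := fun i => iterate_push_dconv φ f _ i
  have hsum := sum_fibreDeficit_iterate_push φ f hf1 (m + 1)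
  rw [hcard] at hsum
  push_cast at hsum
  rw [← hsum]
  refine sum_range_le_of_gain (D := fun i => fibreDeficit φ
    (dconv ((push φ)^[i] f) ((push φ)^[i + 1] f))) hL (fun i => fibreDeficit_nonneg φ _ (h0 i))
    (fun i => fibreDeficit_dconv_le_left φ _ _ (h0 i) (h0 _) (h1 _))
    (fun i => fibreDeficit_dconv_le_right φ _ _ (h0 i) (h0 _) (h1 _))
    (fun i => fibreDeficit_dconv_le_sub φ hq hcard (by linarith) (by linarith) _ _ (h0 _) (h0 _)
      (h1 _) (h1 _)) ?_ hm
  have hsum2 := sum_fibreDeficit_iterate_push φ (dconv f (push φ f))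
    (by rw [sum_dconv, hf1, sum_push, hf1, one_mul]) (m + 1)
  rw [hcard] at hsum2
  push_cast at hsum2
  simp only [hg] at hsum2
  rw [hsum, hsum2]
  have := negEntropy_dconv_le ((push φ)^[m + 1] f) ((push φ)^[m + 1 + 1] f) (h0 _) (h0 _) (h1 _)
    (h1 _)
  linarith

open Classical in
/-- The uniform probability density on a finite set. -/
noncomputable def unif {X : Type*} (A : Finset X) : X → ℝ :=
  fun x => if x ∈ A then 1 / (A.card : ℝ) else 0

lemma unif_nonneg {X : Type*} (A : Finset X) (x : X) : 0 ≤ unif A x := by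
  unfold unif; split_ifs <;> positivity

lemma sum_unif {X : Type*} [Fintype X] {A : Finset X} (hA : A.Nonempty) : ∑ x, unif A x = 1 := by
  have : (A.card : ℝ) ≠ 0 := by exact_mod_cast hA.card_pos.ne'
  simp [unif, this]

lemma negEntropy_unif {X : Type*} [Fintype X] {A : Finset X} (hA : A.Nonempty) :
    negEntropy (unif A) = -Real.log A.card := by
  have : (A.card : ℝ) ≠ 0 := by exact_mod_cast hA.card_pos.ne'
  have h : ∀ x, unif A x * Real.log (unif A x) = -Real.log A.card * unif A x := by
    intro x
    unfold unif
    split_ifs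
    · rw [one_div, Real.log_inv]; ring
    · simp
  unfold negEntropy
  simp only [h]
  rw [← Finset.mul_sum, sum_unif hA, mul_one]

lemma iterate_push_apply (φ : G →+ G) (f : G → ℝ) (i : ℕ) (y : G) [DecidableEq G] :
    (push φ)^[i] f y = ∑ x, if φ^[i] x = y then f x else 0 := by
  induction i generalizing y with
  | zero =>
    rw [Finset.sum_eq_single y] <;> simp +contextual
  | succ i ih =>
    rw [Function.iterate_succ_apply', push]
    have h : ∀ k : G → ℝ, ∑ z, (push φ)^[i] f z * k z = ∑ x, f x * k (φ^[i] x) := by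
      intro k
      simp only [ih, Finset.sum_mul]
      rw [Finset.sum_comm]
      exact Finset.sum_congr rfl fun x _ => by simp [ite_mul]
    have := h fun z => if φ z = y then 1 else 0
    simp only [mul_ite, mul_one, mul_zero] at this
    simp only [Function.iterate_succ_apply']
    rw [← this]
    refine Finset.sum_congr rfl fun z _ => ?_
    congr

lemma neg_log_card_add_image_le [DecidableEq G] (φ : G →+ G) {A : Finset G} (hA : A.Nonempty) :
    -Real.log (A + A.image φ).card ≤ negEntropy (dconv (unif A) (push φ (unif A))) := by
  have h1 : ∀ y, 0 ≤ push φ (unif A) y := push_nonneg φ (unif_nonneg A)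
  refine neg_log_card_le_sum_mul_log _ (dconv_nonneg (unif_nonneg A) h1)
    (by rw [sum_dconv, sum_push, sum_unif hA, one_mul]) _ fun x hx => ?_
  refine Finset.sum_eq_zero fun y _ => ?_
  by_cases hy : y ∈ A
  · have : push φ (unif A) (x - y) = 0 := by
      refine Finset.sum_eq_zero fun z _ => ?_
      split_ifs with hz
      · unfold unif
        rw [if_neg]
        intro hzA
        exact hx (Finset.mem_add.2 ⟨y, hy, φ z, Finset.mem_image_of_mem _ hzA, by rw [hz]; abel⟩)
      · rfl
    rw [this, mul_zero]
  · simp [unif, hy]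

end Chain

lemma card_le_div_add_one {S : Finset ℕ} {N r : ℕ} (hS : S ⊆ Finset.range N)
    (h : ∀ v ∈ S, ∀ w ∈ S, v ≡ w [MOD r]) : S.card ≤ N / r + 1 := by
  rw [← Finset.card_range (N / r + 1)]
  refine Finset.card_le_card_of_injOn (fun v => v / r) (fun v hv => ?_) fun v hv w hw hvw => ?_
  · have := Finset.mem_range.1 (hS hv)
    simp only [Finset.coe_range, Set.mem_Iio]
    exact Nat.lt_succ_of_le (Nat.div_le_div_right this.le)
  · have h1 : v % r = w % r := h v hv w hw
    have h2 : v / r = w / r := hvw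
    rw [← Nat.div_add_mod v r, ← Nat.div_add_mod w r, h1, h2]

section Lift

variable {p q : ℕ} [NeZero p]

/-- Multiplication by `q` on `ℤ/Mℤ`. -/
def mulHom (M q : ℕ) : ZMod M →+ ZMod M := AddMonoidHom.mulLeft (q : ZMod M)

lemma mulHom_apply (M q : ℕ) (x : ZMod M) : mulHom M q x = q * x := rfl

lemma iterate_mulHom (M q i : ℕ) (x : ZMod M) : (mulHom M q)^[i] x = (q : ZMod M) ^ i * x := by
  induction i with
  | zero => simp
  | succ i ih => rw [Function.iterate_succ_apply', ih, mulHom_apply]; ring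

lemma natCast_mul_mod (p N s : ℕ) :
    ((N * (s % p) : ℕ) : ZMod (p * N)) = ((N * s : ℕ) : ZMod (p * N)) := by
  rw [ZMod.natCast_eq_natCast_iff, mul_comm p N]
  exact (Nat.mod_modEq s p).mul_left' N

lemma card_ker_mulHom {M r : ℕ} (hM : 0 < M) (h : M = r * q) [Fintype (mulHom M q).ker] :
    Fintype.card (mulHom M q).ker = q := by
  have hr : 0 < r := Nat.pos_of_ne_zero fun h0 => by simp [h, h0] at hM
  have hq : 0 < q := Nat.pos_of_ne_zero fun h0 => by simp [h, h0] at hM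
  have : NeZero M := ⟨hM.ne'⟩
  refine (Fintype.card_congr (Equiv.ofBijective (fun j : Fin q =>
    (⟨((r * j : ℕ) : ZMod M), ?_⟩ : (mulHom M q).ker)) ⟨?_, ?_⟩)).symm.trans (Fintype.card_fin q)
  · rw [AddMonoidHom.mem_ker, mulHom_apply, ← Nat.cast_mul, ZMod.natCast_eq_zero_iff, h]
    exact ⟨j, by ring⟩
  · intro i j hij
    simp only [Subtype.mk.injEq] at hij
    rw [ZMod.natCast_eq_natCast_iff', Nat.mod_eq_of_lt (h ▸ Nat.mul_lt_mul_of_pos_left i.2 hr),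
      Nat.mod_eq_of_lt (h ▸ Nat.mul_lt_mul_of_pos_left j.2 hr)] at hij
    exact Fin.ext (Nat.eq_of_mul_eq_mul_left hr hij)
  · rintro ⟨x, hx⟩
    have hdvd : q * r ∣ q * x.val := by
      rw [AddMonoidHom.mem_ker, mulHom_apply, ← ZMod.natCast_zmod_val x, ← Nat.cast_mul,
        ZMod.natCast_eq_zero_iff] at hx
      exact (dvd_of_eq ((mul_comm q r).trans h.symm)).trans hx
    obtain ⟨k, hk⟩ := Nat.dvd_of_mul_dvd_mul_left hq hdvd
    have hlt : k < q := by
      have := ZMod.val_lt x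
      rw [hk, h] at this
      exact lt_of_mul_lt_mul_left this hr.le
    refine ⟨⟨k, hlt⟩, Subtype.ext ?_⟩
    simp only
    rw [← hk, ZMod.natCast_zmod_val]

/-- The preimage of `A` under the digit map `ℤ/pNℤ → ℤ/pℤ`, `x ↦ ⌊x / N⌋`. -/
def lift (N : ℕ) (A : Finset (ZMod p)) : Finset (ZMod (p * N)) :=
  (A ×ˢ Finset.range N).image fun z => ((N * z.1.val + z.2 : ℕ) : ZMod (p * N))

lemma card_lift (N : ℕ) (A : Finset (ZMod p)) : (lift N A).card = A.card * N := by
  rw [lift, Finset.card_image_of_injOn, Finset.card_product, Finset.card_range]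
  rintro ⟨a, v⟩ h1 ⟨b, w⟩ h2 h
  simp only [Finset.coe_product, Set.mem_prod, Finset.mem_coe, Finset.mem_range] at h1 h2
  have hlt : ∀ (a : ZMod p) (v : ℕ), v < N → N * a.val + v < p * N := fun a v hv => by
    have := ZMod.val_lt a
    nlinarith
  simp only at h
  rw [ZMod.natCast_eq_natCast_iff', Nat.mod_eq_of_lt (hlt _ _ h1.2),
    Nat.mod_eq_of_lt (hlt _ _ h2.2)] at h
  have hN : 0 < N := by omega
  have e1 : a.val = b.val := by
    have := congrArg (· / N) h
    simpa [Nat.mul_add_div hN, Nat.div_eq_of_lt h1.2, Nat.div_eq_of_lt h2.2] using this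
  rw [e1] at h
  rw [ZMod.val_injective p e1, Nat.add_left_cancel h]

lemma card_lift_add_le {N : ℕ} (hN : 0 < N) (A T : Finset (ZMod p))
    (hT : ∀ a ∈ A, ∀ b ∈ A, ∀ c ≤ q, a + q * b + c ∈ T) :
    (lift N A + (lift N A).image (mulHom (p * N) q)).card ≤ T.card * N := by
  refine le_trans (Finset.card_le_card (t := (T ×ˢ Finset.range N).image
    fun z => ((N * z.1.val + z.2 : ℕ) : ZMod (p * N))) ?_)
    (Finset.card_image_le.trans (by rw [Finset.card_product, Finset.card_range]))
  intro x hx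
  obtain ⟨y, hy, z', hz', rfl⟩ := Finset.mem_add.1 hx
  obtain ⟨z, hz, rfl⟩ := Finset.mem_image.1 hz'
  obtain ⟨⟨a, v⟩, hav, rfl⟩ := Finset.mem_image.1 hy
  obtain ⟨⟨b, w⟩, hbw, rfl⟩ := Finset.mem_image.1 hz
  simp only [Finset.mem_product, Finset.mem_range] at hav hbw
  have hc : (v + q * w) / N ≤ q := by
    rw [← Nat.lt_succ_iff, Nat.div_lt_iff_lt_mul hN]
    have : q * w ≤ q * N := Nat.mul_le_mul_left q hbw.2.le
    have e : q.succ * N = q * N + N := Nat.succ_mul q N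
    omega
  refine Finset.mem_image.2 ⟨(a + q * b + ((v + q * w) / N : ℕ), (v + q * w) % N), ?_, ?_⟩
  · exact Finset.mem_product.2 ⟨hT a hav.1 b hbw.1 _ hc, Finset.mem_range.2 (Nat.mod_lt _ hN)⟩
  · have hval : a + q * b + (((v + q * w) / N : ℕ) : ZMod p) =
        ((a.val + q * b.val + (v + q * w) / N : ℕ) : ZMod p) := by
      push_cast
      rw [ZMod.natCast_zmod_val, ZMod.natCast_zmod_val]
    simp only [mulHom_apply]
    rw [hval, ZMod.val_natCast]
    rw [Nat.cast_add, natCast_mul_mod, ← Nat.cast_add, ← Nat.cast_mul, ← Nat.cast_add]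
    congr 1
    have := Nat.div_add_mod (v + q * w) N
    linarith

lemma iterate_push_unif_lift_le {N i r : ℕ} (hq : 0 < q) (hr : 0 < r) (hrN : r ≤ N) (hN : r * q ^ i = p * N)
    {A : Finset (ZMod p)} (hA : A.Nonempty) [Fintype (ZMod (p * N))] (y : ZMod (p * N)) :
    (push (mulHom (p * N) q))^[i] (unif (lift N A)) y ≤ 2 / r := by
  classical
  rw [iterate_push_apply]
  have hNpos : 0 < N := hr.trans_le hrN
  have e : ∑ x, (if (mulHom (p * N) q)^[i] x = y then unif (lift N A) x else 0) =
      ((lift N A).filter fun x => (q : ZMod (p * N)) ^ i * x = y).card / (lift N A).card := by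
    rw [← Finset.sum_boole, div_eq_mul_one_div, Finset.sum_mul]
    rw [← Finset.sum_subset (Finset.subset_univ (lift N A))]
    · refine Finset.sum_congr rfl fun x hx => ?_
      simp only [iterate_mulHom, unif, hx, if_true, ite_mul, one_mul, zero_mul]
    · intro x _ hx
      simp [unif, hx]
  rw [e]
  have hcount : ((lift N A).filter fun x => (q : ZMod (p * N)) ^ i * x = y).card ≤
      A.card * (N / r + 1) := by
    rw [lift, Finset.filter_image]
    refine Finset.card_image_le.trans ?_
    rw [Finset.card_filter, Finset.sum_product]
    refine (Finset.sum_le_card_nsmul _ _ (N / r + 1) fun a _ => ?_).trans_eq (smul_eq_mul _ _)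
    rw [← Finset.card_filter]
    refine card_le_div_add_one (Finset.filter_subset _ _) fun v hv w hw => ?_
    simp only [Finset.mem_filter] at hv hw
    have h := hv.2.trans hw.2.symm
    rw [← Nat.cast_pow, ← Nat.cast_mul, ← Nat.cast_mul, ZMod.natCast_eq_natCast_iff, ← hN,
      mul_comm r] at h
    exact Nat.ModEq.add_left_cancel' _ (Nat.ModEq.mul_left_cancel' (pow_pos hq i).ne' h)
  rw [card_lift]
  have hA0 : (0 : ℝ) < A.card := by exact_mod_cast hA.card_pos
  have hN0 : (0 : ℝ) < N := by exact_mod_cast hNpos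
  have hr0 : (0 : ℝ) < r := by exact_mod_cast hr
  have hrN' : (r : ℝ) ≤ N := by exact_mod_cast hrN
  have h1 : (((lift N A).filter fun x => (q : ZMod (p * N)) ^ i * x = y).card : ℝ) ≤
      A.card * (((N / r : ℕ) : ℝ) + 1) := by exact_mod_cast hcount
  have h2 : ((N / r : ℕ) : ℝ) ≤ N / r := Nat.cast_div_le
  have h3 : (1 : ℝ) ≤ N / r := by rw [le_div_iff₀ hr0]; linarith
  push_cast
  rw [div_le_div_iff₀ (by positivity) hr0]
  have h4 : (A.card : ℝ) * (((N / r : ℕ) : ℝ) + 1) ≤ A.card * (2 * (N / r)) :=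
    mul_le_mul_of_nonneg_left (by linarith) hA0.le
  calc _ ≤ (A.card : ℝ) * (2 * (N / r)) * r := mul_le_mul_of_nonneg_right (h1.trans h4) hr0.le
    _ = _ := by field_simp

lemma neg_log_le_negEntropy_iterate_push {N i : ℕ} [Fintype (ZMod (p * N))] [NeZero N]
    (hN : q ^ i = N) (f : ZMod (p * N) → ℝ) (hf : ∀ x, 0 ≤ f x) (hf1 : ∑ x, f x = 1) :
    -Real.log p ≤ negEntropy ((push (mulHom (p * N) q))^[i] f) := by
  classical
  set T : Finset (ZMod (p * N)) := (Finset.range p).image fun k => ((N * k : ℕ) : ZMod (p * N))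
    with hT
  have hTs : ∀ y ∉ T, (push (mulHom (p * N) q))^[i] f y = 0 := by
    intro y hy
    rw [iterate_push_apply]
    refine Finset.sum_eq_zero fun x _ => if_neg ?_
    rintro rfl
    refine hy ?_
    rw [hT, Finset.mem_image]
    refine ⟨x.val % p, Finset.mem_range.2 (Nat.mod_lt _ (Nat.pos_of_ne_zero (NeZero.ne p))), ?_⟩
    have : NeZero (p * N) := ⟨mul_ne_zero (NeZero.ne p) (NeZero.ne N)⟩
    rw [natCast_mul_mod, iterate_mulHom, ← Nat.cast_pow, hN, Nat.cast_mul, ZMod.natCast_zmod_val]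
  have h := neg_log_card_le_sum_mul_log _ (iterate_push_nonneg _ hf i)
    (by rw [sum_iterate_push, hf1]) T hTs
  refine le_trans (neg_le_neg ?_) h
  have hc : T.card ≤ p := Finset.card_image_le.trans_eq (Finset.card_range p)
  have hTn : 0 < T.card := by
    rw [Finset.card_pos, hT]
    exact (Finset.nonempty_range_iff.2 (NeZero.ne p)).image _
  exact Real.log_le_log (by exact_mod_cast hTn) (by exact_mod_cast hc)

end Lift

/-- If `A + q·A + {0, …, q}` is contained in a set `T` which is not much larger than `A`, then `A`
is dense. -/
lemma log_div_card_le {p q : ℕ} [NeZero p] (hq : q.Prime) {A T : Finset (ZMod p)}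
    (hA : A.Nonempty) (hT : ∀ a ∈ A, ∀ b ∈ A, ∀ c ≤ q, a + q * b + c ∈ T) {L : ℝ}
    (hL : 0 ≤ L) (hTL : Real.log (T.card / A.card) ≤ L) (hlog : 8 * (L + 1) + 4 ≤ Real.log q) :
    Real.log (p / A.card) ≤ 20480002 * (L + 1) ^ 2 := by
  classical
  have hp0 : 0 < p := Nat.pos_of_ne_zero (NeZero.ne p)
  obtain ⟨m, hm⟩ : ∃ m, p * q < q ^ (m + 1) := by
    obtain ⟨m, hm⟩ := pow_unbounded_of_one_lt (p * q) hq.one_lt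
    exact ⟨m, hm.trans_le (Nat.pow_le_pow_right hq.pos (Nat.le_succ m))⟩
  set N := q ^ (m + 1) with hN
  have hN0 : 0 < N := pow_pos hq.pos _
  have : NeZero N := ⟨hN0.ne'⟩
  have : NeZero (p * N) := ⟨mul_ne_zero (NeZero.ne p) (NeZero.ne N)⟩
  set φ := mulHom (p * N) q with hφ
  have hkerN : p * N = (p * q ^ m) * q := by rw [hN]; ring
  have hker : Fintype.card φ.ker = q := card_ker_mulHom (Nat.mul_pos hp0 hN0) hkerN
  have hcard := card_lift N A
  have hA0 : (0 : ℝ) < A.card := by exact_mod_cast hA.card_pos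
  have hNr : (0 : ℝ) < N := by exact_mod_cast hN0
  have hpr : (0 : ℝ) < p := by exact_mod_cast hp0
  have hqr : (0 : ℝ) < q := by exact_mod_cast hq.pos
  have hlift : (lift N A).Nonempty := by
    rw [← Finset.card_pos, hcard]; exact Nat.mul_pos hA.card_pos hN0
  set f := unif (lift N A) with hf
  have hf0 : ∀ x, 0 ≤ f x := unif_nonneg _
  have hf1 : ∑ x, f x = 1 := sum_unif hlift
  have hSf : negEntropy f = -(Real.log A.card + Real.log N) := by
    rw [hf, negEntropy_unif hlift, hcard, Nat.cast_mul, Real.log_mul hA0.ne' hNr.ne']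
  have hTcard : (lift N A + (lift N A).image φ).card ≤ T.card * N := card_lift_add_le hN0 A T hT
  have hT0 : 0 < T.card := by
    obtain ⟨a, ha⟩ := hA
    exact Finset.card_pos.2 ⟨_, hT a ha a ha 0 (Nat.zero_le q)⟩
  have hTr : (0 : ℝ) < T.card := by exact_mod_cast hT0
  have hfL : negEntropy f - negEntropy (dconv f (push φ f)) ≤ L := by
    have h1 := neg_log_card_add_image_le φ hlift
    have h2 : Real.log (lift N A + (lift N A).image φ).card ≤ Real.log T.card + Real.log N := by
      rw [← Real.log_mul hTr.ne' hNr.ne']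
      refine Real.log_le_log ?_ (by exact_mod_cast hTcard)
      exact_mod_cast (hlift.add (hlift.image φ)).card_pos
    rw [Real.log_div hTr.ne' hA0.ne'] at hTL
    rw [hSf]
    linarith
  have hpN : p ≤ N := (Nat.le_mul_of_pos_right p hq.pos).trans hm.le
  have hn : ∀ x, (push φ)^[m + 1] f x ≤ 2 / p := fun x =>
    iterate_push_unif_lift_le hq.pos hp0 hpN rfl hA x
  have hn' : ∀ x, (push φ)^[m] f x ≤ 2 / (p * q) := fun x => by
    have := iterate_push_unif_lift_le (q := q) (i := m) (r := p * q) (N := N)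
      hq.pos (Nat.mul_pos hp0 hq.pos) hm.le (by rw [hN]; ring) hA x
    exact_mod_cast this
  have h1 := iterate_push_nonneg φ hf0
  have h2 : ∀ i, ∑ x, (push φ)^[i] f x = 1 := fun i => by rw [sum_iterate_push, hf1]
  have hb := sum_mul_log_le_log _ (h1 (m + 1)) (h2 (m + 1)) hn
  have hb' := sum_mul_log_le_log _ (h1 m) (h2 m) hn'
  have hlow := neg_log_le_negEntropy_iterate_push (p := p) (q := q) hN.symm f hf0 hf1
  have hd : fibreDeficit φ ((push φ)^[m] f) ≤ 1 := by
    rw [fibreDeficit_eq φ _ (h2 m), hker, ← Function.iterate_succ_apply' (push φ)]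
    rw [Real.log_div two_ne_zero (by positivity), Real.log_mul hpr.ne' hqr.ne'] at hb'
    have := Real.log_two_lt_d9
    change negEntropy ((push φ)^[m] f) ≤ _ at hb'
    linarith
  have hmain := negEntropy_le_of_gain φ hq hker hL hlog f hf0 hf1 hfL m hd
  change negEntropy ((push φ)^[m + 1] f) ≤ _ at hb
  rw [Real.log_div two_ne_zero (by positivity)] at hb
  have hlogN : Real.log N = (m + 1) * Real.log q := by
    rw [hN]; push_cast; rw [Real.log_pow]; push_cast; ring
  rw [hSf, hlogN] at hmain
  rw [Real.log_div hpr.ne' hA0.ne']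
  have := Real.log_two_lt_d9
  nlinarith

/-- Van der Waerden's theorem, with a bound on the common difference. -/
lemma exists_mono_progression (n m : ℕ) : ∃ W : ℕ, ∀ C : ℕ → Fin m,
    ∃ a b : ℕ, 0 < a ∧ a ≤ W ∧ ∀ j ≤ n, C (b + a * j) = C b := by
  classical
  obtain ⟨ι, _, hι⟩ :=
    Combinatorics.Line.exists_mono_in_high_dimension (Fin (n + 1)) (Fin m)
  refine ⟨Fintype.card ι, fun C => ?_⟩
  obtain ⟨l, c, hl⟩ := hι fun v => C (∑ i, (v i : ℕ))
  set s : Finset ι := {i | l.idxFun i = none} with hs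
  have hsum : ∀ x : Fin (n + 1), ∑ i, (l x i : ℕ) = ∑ i, (l 0 i : ℕ) + s.card * x := by
    intro x
    rw [hs, Finset.card_filter, Finset.sum_mul, ← Finset.sum_add_distrib]
    refine Finset.sum_congr rfl fun i _ => ?_
    rcases h : l.idxFun i with _ | y
    · simp [h]
    · simp [h]
  obtain ⟨i, hi⟩ := l.proper
  refine ⟨s.card, ∑ i, (l 0 i : ℕ), Finset.card_pos.2 ⟨i, by simpa [hs] using hi⟩,
    Finset.card_le_univ s, fun j hj => ?_⟩
  have h1 := hl ⟨j, Nat.lt_succ_of_le hj⟩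
  have h0 := hl 0
  simp only at h1 h0
  rw [hsum] at h1
  exact h1.trans h0.symm

/-- If `A` is dense in `ℤ/pℤ`, then `A - A - (A - A)` contains a long progression through `0`. -/
lemma exists_progression_subset (n m : ℕ) : ∃ W : ℕ, ∀ p : ℕ, p.Prime → W < p →
    ∀ A : Finset (ZMod p), A.Nonempty → p ≤ m * A.card →
    ∃ d : ZMod p, d ≠ 0 ∧ ∀ j ≤ n, d * j ∈ (A - A) - (A - A) := by
  classical
  obtain ⟨W, hW⟩ := exists_mono_progression n m
  refine ⟨W, fun p hp hWp A hA hpA => ?_⟩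
  have : NeZero p := ⟨hp.ne_zero⟩
  obtain ⟨F, -, hFm, hF⟩ := Finset.ruzsa_covering_add (A := Finset.univ) (K := m) hA (by
    refine le_trans (Nat.cast_le.2 (Finset.card_le_univ _)) ?_
    rw [ZMod.card]
    exact_mod_cast hpA)
  have hFm' : F.card ≤ m := by exact_mod_cast hFm
  have hcov : ∀ k : ℕ, ∃ f : F, (k : ZMod p) - f ∈ A - A := by
    intro k
    obtain ⟨f, hf, d, hd, h⟩ := Finset.mem_add.1 (hF (Finset.mem_univ (k : ZMod p)))
    exact ⟨⟨f, hf⟩, by rwa [← h, add_sub_cancel_left]⟩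
  choose c hc using hcov
  obtain ⟨a, b, ha, haW, h⟩ := hW fun k => Fin.castLE hFm' (F.equivFin (c k))
  refine ⟨a, fun h0 => ?_, fun j hj => ?_⟩
  · rw [ZMod.natCast_eq_zero_iff] at h0
    exact absurd (Nat.le_of_dvd ha h0) (by omega)
  · have hcj : c (b + a * j) = c b := F.equivFin.injective (Fin.castLE_injective hFm' (h j hj))
    have h1 := hc (b + a * j)
    rw [hcj] at h1
    have := Finset.sub_mem_sub h1 (hc b)
    convert this using 1
    push_cast
    ring

section Dilate

variable {G : Type*} [AddCommGroup G] [DecidableEq G]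

/-- If `A + B` is small and `B` has the same size as `A`, then so are sums of several copies of
`A` and `B`. -/
lemma card_iterated_sum_le {A B T : Finset G} (hA : A.Nonempty) (hAB : B.card = A.card) {K : ℝ}
    (hK1 : 1 ≤ K) (hK : ((A + B).card : ℝ) ≤ K * A.card)
    (hT : T ⊆ A + B + ((A - A) - (A - A))) : (T.card : ℝ) ≤ (2 * K ^ 2) ^ 6 * A.card := by
  have hA0 : (0 : ℝ) < A.card := by exact_mod_cast hA.card_pos
  have hAA : ((A + A).card : ℝ) ≤ K ^ 2 * A.card := by
    have h := Finset.ruzsa_triangle_inequality_add_add_add A B A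
    rw [add_comm B A, hAB] at h
    have h' : ((A + A).card : ℝ) * A.card ≤ (A + B).card * (A + B).card := by exact_mod_cast h
    have h2 : ((A + B).card : ℝ) * (A + B).card ≤ (K * A.card) * (K * A.card) :=
      mul_le_mul hK hK (by positivity) (by positivity)
    refine le_of_mul_le_mul_right (h'.trans (h2.trans_eq ?_)) hA0
    ring
  have hsum : ((A + (A ∪ B)).card : ℝ) ≤ 2 * K ^ 2 * A.card := by
    rw [Finset.add_union]
    have h : (((A + A) ∪ (A + B)).card : ℝ) ≤ (A + A).card + (A + B).card := by
      exact_mod_cast Finset.card_union_le _ _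
    nlinarith
  have hsub : T ⊆ 4 • (A ∪ B) - 2 • (A ∪ B) := by
    have hA' : A ⊆ A ∪ B := Finset.subset_union_left
    have hB' : B ⊆ A ∪ B := Finset.subset_union_right
    refine hT.trans ((Finset.add_subset_add (Finset.add_subset_add hA' hB')
      (Finset.sub_subset_sub (Finset.sub_subset_sub hA' hA')
        (Finset.sub_subset_sub hA' hA'))).trans_eq ?_)
    simp only [sub_eq_add_neg, neg_add, neg_neg, two_nsmul]
    generalize -(A ∪ B) = V
    abel
  have hpl := Finset.pluennecke_ruzsa_inequality_nsmul_sub_nsmul_add hA (A ∪ B) 4 2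
  have hpl' : ((4 • (A ∪ B) - 2 • (A ∪ B)).card : ℝ) ≤
      ((A + (A ∪ B)).card / A.card : ℝ) ^ 6 * A.card := by
    have := NNRat.cast_le (K := ℝ) |>.2 hpl
    push_cast at this
    exact this
  refine le_trans (by exact_mod_cast Finset.card_le_card hsub) (hpl'.trans ?_)
  gcongr
  rwa [div_le_iff₀ hA0]

end Dilate

/-- Dense sets for which `A + q·A` is small are of nearly full density. -/
lemma log_div_card_le_of_card_add_le {q : ℕ} (hq : q.Prime) (m : ℕ) : ∃ W : ℕ, ∀ p : ℕ, p.Prime →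
    W < p → ∀ A : Finset (ZMod p), A.Nonempty → p ≤ m * A.card → ∀ K : ℝ, 1 ≤ K →
    ((A + A.image fun a => (q : ZMod p) * a).card : ℝ) ≤ K * A.card →
    52 + 96 * Real.log K ≤ Real.log q →
    Real.log (p / A.card) ≤ 20480002 * (6 + 12 * Real.log K) ^ 2 := by
  obtain ⟨W, hW⟩ := exists_progression_subset q m
  refine ⟨max W q, fun p hp hWp A hA hpA K hK1 hK hlog => ?_⟩
  have : Fact p.Prime := ⟨hp⟩
  obtain ⟨d, hd, hj⟩ := hW p hp ((le_max_left _ _).trans_lt hWp) A hA hpA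
  have hq0 : (q : ZMod p) ≠ 0 := by
    rw [Ne, ZMod.natCast_eq_zero_iff]
    exact fun h => absurd (Nat.le_of_dvd hq.pos h) (not_le.2 ((le_max_right _ _).trans_lt hWp))
  set ψ : ZMod p →+ ZMod p := AddMonoidHom.mulLeft d⁻¹ with hψ
  have hψi : Function.Injective ψ := mul_right_injective₀ (inv_ne_zero hd)
  have hcard : (A.image ψ).card = A.card := Finset.card_image_of_injective _ hψi
  have hcomm : (A.image ψ).image (fun a => (q : ZMod p) * a) =
      (A.image fun a => (q : ZMod p) * a).image ψ := by
    rw [Finset.image_image, Finset.image_image]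
    refine Finset.image_congr fun a _ => ?_
    simp only [hψ, Function.comp_apply, AddMonoidHom.coe_mulLeft]
    ring
  set B := (A.image ψ).image fun a => (q : ZMod p) * a with hB
  have hBcard : B.card = (A.image ψ).card :=
    Finset.card_image_of_injective _ (mul_right_injective₀ hq0)
  have hAB : (A.image ψ + B).card = (A + A.image fun a => (q : ZMod p) * a).card := by
    rw [hcomm, ← Finset.image_add, Finset.card_image_of_injective _ hψi]
  have himage_sub : ∀ S S' : Finset (ZMod p), (S - S').image ψ = S.image ψ - S'.image ψ :=
    fun S S' => Finset.image_image₂_distrib (map_sub ψ)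
  set T := A.image ψ + B + (Finset.range (q + 1)).image (Nat.cast : ℕ → ZMod p) with hT
  have hTsub : T ⊆ A.image ψ + B + ((A.image ψ - A.image ψ) - (A.image ψ - A.image ψ)) := by
    refine Finset.add_subset_add_left fun x hx => ?_
    obtain ⟨c, hc, rfl⟩ := Finset.mem_image.1 hx
    rw [← himage_sub, ← himage_sub, Finset.mem_image]
    refine ⟨d * c, hj c (Nat.lt_succ_iff.1 (Finset.mem_range.1 hc)), ?_⟩
    simp [hψ, hd]
  have hA' : (A.image ψ).Nonempty := hA.image ψ
  have hTc := card_iterated_sum_le hA' hBcard hK1 (by rw [hAB, hcard]; exact hK) hTsub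
  have hA0 : (0 : ℝ) < (A.image ψ).card := by exact_mod_cast hA'.card_pos
  have hK0 : 0 ≤ Real.log K := Real.log_nonneg hK1
  have hT0 : (0 : ℝ) < T.card := by
    have : T.Nonempty := (hA'.add (hA'.image _)).add
      ((Finset.nonempty_range_iff.2 (by simp)).image _)
    exact_mod_cast this.card_pos
  have hTL : Real.log (T.card / (A.image ψ).card) ≤ 5 + 12 * Real.log K := by
    have h1 : Real.log (T.card / (A.image ψ).card) ≤ Real.log ((2 * K ^ 2) ^ 6) :=
      Real.log_le_log (by positivity) (by rwa [div_le_iff₀ hA0])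
    rw [Real.log_pow, Real.log_mul two_ne_zero (by positivity), Real.log_pow] at h1
    have := Real.log_two_lt_d9
    push_cast at h1
    linarith
  have h := log_div_card_le hq hA' (T := T) (fun a ha b hb c hc => ?_) (by positivity) hTL
    (by linarith)
  · rw [hcard] at h
    calc _ ≤ _ := h
      _ = _ := by ring
  · exact Finset.add_mem_add (Finset.add_mem_add ha (Finset.mem_image_of_mem _ hb))
      (Finset.mem_image.2 ⟨c, Finset.mem_range.2 (Nat.lt_succ_of_le hc), rfl⟩)

lemma exists_subset_card_bounds {p : ℕ} {α : ℝ} (hα : 0 < α) (hp : 4 / α ≤ p)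
    {A : Finset (ZMod p)} (hA : α * p ≤ A.card) :
    ∃ A' ⊆ A, A'.Nonempty ∧ α * p ≤ A'.card ∧ (A'.card : ℝ) ≤ 2 * (α * p) := by
  rw [div_le_iff₀ hα] at hp
  obtain ⟨A', hA', hc⟩ := Finset.exists_subset_card_eq (Nat.ceil_le.2 hA)
  have h1 := Nat.le_ceil (α * p)
  have h2 := Nat.ceil_lt_add_one (a := α * p) (by linarith)
  refine ⟨A', hA', ?_, by rwa [hc], by rw [hc]; linarith⟩
  rw [← Finset.card_pos, hc, Nat.ceil_pos]
  linarith

lemma le_card_add_image {p : ℕ} (hp : p.Prime) {α : ℝ} (hα : 0 < α) (hα2 : α < 1 / 2)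
    (hpα : 4 / α ≤ p) {c : ZMod p} (hc : c ≠ 0) {A : Finset (ZMod p)} (hA : α * p ≤ A.card) :
    3 / 2 * (α * p) ≤ ((A + A.image fun a => c * a).card : ℝ) := by
  have : Fact p.Prime := ⟨hp⟩
  rw [div_le_iff₀ hα] at hpα
  have hA0 : A.Nonempty := by
    rw [← Finset.card_pos]
    exact_mod_cast (by linarith : (0 : ℝ) < A.card)
  have h := ZMod.cauchy_davenport hp hA0 (hA0.image fun a => c * a)
  rw [Finset.card_image_of_injective _ (mul_right_injective₀ hc)] at h
  rcases min_le_iff.1 h with h | h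
  · have h' : (p : ℝ) ≤ (A + A.image fun a => c * a).card := by exact_mod_cast h
    have : (0 : ℝ) < p := by exact_mod_cast hp.pos
    nlinarith
  · have h' : (A.card : ℝ) + A.card ≤ (A + A.image fun a => c * a).card + 1 := by
      exact_mod_cast Nat.sub_le_iff_le_add.1 h
    linarith

/-- Sets of density at least `α` grow by a factor at least `K` under `A ↦ A + q·A`, provided `K` is
small in terms of `α`. -/
lemma eventually_mul_le_card_add {α K : ℝ} (hα : 0 < α) (hK1 : 1 ≤ K)
    (hαK : 20480002 * (6 + 12 * Real.log K) ^ 2 + 1 < Real.log (1 / α)) {q : ℕ} (hq : q.Prime)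
    (hlog : 52 + 96 * Real.log K ≤ Real.log q) :
    ∀ᶠ p : ℕ in atTop, p.Prime → ∀ A : Finset (ZMod p), α * p ≤ A.card →
      K * α * p ≤ ((A + A.image fun a => (q : ZMod p) * a).card : ℝ) := by
  obtain ⟨W, hW⟩ := log_div_card_le_of_card_add_le hq ⌈1 / α⌉₊
  filter_upwards [eventually_gt_atTop W, eventually_ge_atTop ⌈4 / α⌉₊] with p hWp hpα hp A hA
  obtain ⟨A', hA'A, hA', h1, h2⟩ := exists_subset_card_bounds hα (Nat.ceil_le.1 hpα) hA
  have hp0 : (0 : ℝ) < p := by exact_mod_cast hp.pos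
  have hA0 : (0 : ℝ) < A'.card := by exact_mod_cast hA'.card_pos
  by_contra! hlt
  have hle : ((A' + A'.image fun a => (q : ZMod p) * a).card : ℝ) ≤ K * A'.card := by
    refine le_trans (Nat.cast_le.2 (Finset.card_le_card
      (Finset.add_subset_add hA'A (Finset.image_subset_image hA'A)))) (hlt.le.trans ?_)
    rw [mul_assoc]
    exact mul_le_mul_of_nonneg_left h1 (by linarith)
  have hm : p ≤ ⌈1 / α⌉₊ * A'.card := by
    have h3 : (p : ℝ) ≤ 1 / α * A'.card := by
      rw [one_div, inv_mul_eq_div, le_div_iff₀ hα, mul_comm]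
      exact h1
    have h4 := mul_le_mul_of_nonneg_right (Nat.le_ceil (1 / α)) hA0.le
    exact_mod_cast h3.trans h4
  have h := hW p hp hWp A' hA' hm K hK1 hle hlog
  have h5 : Real.log (1 / α / 2) ≤ Real.log (p / A'.card) := by
    refine Real.log_le_log (by positivity) ?_
    rw [div_div, div_le_div_iff₀ (by positivity) hA0]
    linarith
  rw [Real.log_div (by positivity) two_ne_zero] at h5
  have := Real.log_two_lt_d9
  linarith

lemma exZMod_nonneg (p : ℕ) (lam : ℤ) (α : ℝ) : 0 ≤ exZMod p lam α :=
  Real.sInf_nonneg fun x ⟨_, _, hx⟩ => hx ▸ by positivity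

lemma exZMod_le_one {p : ℕ} (hp : p.Prime) (lam : ℤ) {α : ℝ} (hα : α ≤ 1) :
    exZMod p lam α ≤ 1 := by
  have : NeZero p := ⟨hp.ne_zero⟩
  have hp0 : (0 : ℝ) < p := by exact_mod_cast hp.pos
  refine le_trans (csInf_le ⟨0, ?_⟩ ⟨Finset.univ, ?_, rfl⟩) ?_
  · rintro _ ⟨_, _, rfl⟩
    positivity
  · rw [Finset.card_univ, ZMod.card]
    nlinarith
  · rw [div_le_one hp0]
    exact_mod_cast (Finset.card_le_univ _).trans_eq (ZMod.card p)

lemma le_exZMod {p : ℕ} (hp : p.Prime) (lam : ℤ) {α t : ℝ} (hα : α ≤ 1)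
    (h : ∀ A : Finset (ZMod p), α * p ≤ A.card →
      t * p ≤ ((A + A.image fun a => (lam : ZMod p) * a).card : ℝ)) : t ≤ exZMod p lam α := by
  have : NeZero p := ⟨hp.ne_zero⟩
  have hp0 : (0 : ℝ) < p := by exact_mod_cast hp.pos
  refine le_csInf ⟨_, Finset.univ, ?_, rfl⟩ ?_
  · rw [Finset.card_univ, ZMod.card]
    nlinarith
  · rintro _ ⟨A, hA, rfl⟩
    rw [le_div_iff₀ hp0]
    exact h A hA

lemma frequently_atTop_prime : ∃ᶠ p : ℕ in atTop, p.Prime :=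
  Nat.frequently_atTop_iff_infinite.2 Nat.infinite_setOfPred_prime

instance neBot_atTop_inf_principal_prime : (atTop ⊓ 𝓟 {p : ℕ | p.Prime}).NeBot :=
  frequently_mem_iff_neBot.1 frequently_atTop_prime

lemma eventually_prime : ∀ᶠ p in atTop ⊓ 𝓟 {p : ℕ | p.Prime}, p.Prime :=
  mem_inf_of_right (mem_principal_self _)

lemma le_exLam {lam : ℤ} {α t : ℝ} (hα : α ≤ 1)
    (h : ∀ᶠ p : ℕ in atTop, p.Prime → ∀ A : Finset (ZMod p), α * p ≤ A.card →
      t * p ≤ ((A + A.image fun a => (lam : ZMod p) * a).card : ℝ)) : t ≤ exLam lam α := by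
  have h' : ∀ᶠ p in atTop ⊓ 𝓟 {p : ℕ | p.Prime}, t ≤ exZMod p lam α := by
    filter_upwards [eventually_prime, h.filter_mono inf_le_left] with p hp hA
    exact le_exZMod hp lam hα (hA hp)
  exact le_limsup_of_frequently_le h'.frequently
    (isBoundedUnder_of_eventually_le (a := 1)
      (eventually_prime.mono fun _ hp => exZMod_le_one hp lam hα))

lemma exLam_le_one (lam : ℤ) {α : ℝ} (hα : α ≤ 1) : exLam lam α ≤ 1 :=
  limsup_le_of_le (isCoboundedUnder_le_of_le _ fun p => exZMod_nonneg p lam α)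
    (eventually_prime.mono fun _ hp => exZMod_le_one hp lam hα)

lemma le_exD {α t : ℝ} (hα : α ≤ 1) (h : ∃ᶠ lam : ℤ in atTop, t ≤ exLam lam α) : t ≤ exD α :=
  le_limsup_of_frequently_le h
    (isBoundedUnder_of_eventually_le (a := 1) (Eventually.of_forall fun lam => exLam_le_one lam hα))

lemma mul_le_exD_of_le {α K : ℝ} (hα : 0 < α) (hα2 : α < 1 / 2) (hK : K ≤ 3 / 2) :
    K * α ≤ exD α := by
  refine le_exD (by linarith) (Eventually.frequently ?_)
  filter_upwards [eventually_gt_atTop 0] with lam hlam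
  refine le_exLam (by linarith) ?_
  filter_upwards [eventually_gt_atTop lam.toNat, eventually_ge_atTop ⌈4 / α⌉₊] with p h1 h2 hp A hA
  refine le_trans ?_ (le_card_add_image hp hα hα2 (Nat.ceil_le.1 h2) (fun h0 => ?_) hA)
  · rw [mul_assoc]
    exact mul_le_mul_of_nonneg_right hK (by positivity)
  · rw [ZMod.intCast_zmod_eq_zero_iff_dvd] at h0
    have := Int.le_of_dvd hlam h0
    omega

lemma mul_le_exD_of_log {α K : ℝ} (hα : 0 < α) (hα1 : α ≤ 1) (hK1 : 1 ≤ K)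
    (hαK : 20480002 * (6 + 12 * Real.log K) ^ 2 + 1 < Real.log (1 / α)) : K * α ≤ exD α := by
  refine le_exD hα1 ((tendsto_natCast_atTop_atTop (R := ℤ)).frequently ?_)
  have hlog : ∀ᶠ q : ℕ in atTop, 52 + 96 * Real.log K ≤ Real.log q :=
    (Real.tendsto_log_atTop.comp tendsto_natCast_atTop_atTop).eventually_ge_atTop _
  refine (frequently_atTop_prime.and_eventually hlog).mono fun q hq => le_exLam hα1 ?_
  simpa using eventually_mul_le_card_add hα hK1 hαK hq.1 hq.2

end DilateSum

/-- There exists a constant `C' > 0` such that for all `α ∈ (0, 1/2)`,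
`ex(α) ≥ e^{C'·(log(1/α))^{1/7}}·α`. -/
theorem exD_lower_bound :
    ∃ C' : ℝ, 0 < C' ∧ ∀ α : ℝ, 0 < α → α < 1 / 2 →
      Real.exp (C' * Real.log (1 / α) ^ ((1 : ℝ) / 7)) * α ≤ exD α := by
  refine ⟨1 / (10 * 10 ^ 30), by positivity, fun α hα hα2 => ?_⟩
  set ℓ := Real.log (1 / α) with hℓ
  have hℓ0 : 0 < ℓ := Real.log_pos (by rw [lt_div_iff₀ hα]; linarith)
  have hr0 : 0 ≤ ℓ ^ ((1 : ℝ) / 7) := Real.rpow_nonneg hℓ0.le _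
  have hr7 : (ℓ ^ ((1 : ℝ) / 7)) ^ 7 = ℓ := by
    rw [← Real.rpow_natCast, ← Real.rpow_mul hℓ0.le]
    norm_num
  set r := ℓ ^ ((1 : ℝ) / 7) with hr
  rcases le_or_gt r (10 ^ 30) with h | h
  · refine DilateSum.mul_le_exD_of_le hα hα2 ?_
    have h1 : 1 / (10 * 10 ^ 30) * r ≤ 1 / 10 := by
      rw [one_div_mul_eq_div, div_le_iff₀ (by positivity)]
      linarith
    have h2 := Real.abs_exp_sub_one_le (x := 1 / (10 * 10 ^ 30) * r)
      (by rw [abs_of_nonneg (by positivity)]; linarith)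
    rw [abs_of_nonneg (a := 1 / (10 * 10 ^ 30) * r) (by positivity)] at h2
    linarith [(abs_le.1 h2).2]
  · refine DilateSum.mul_le_exD_of_log hα (by linarith) (Real.one_le_exp (by positivity)) ?_
    rw [Real.log_exp, ← hℓ, ← hr7]
    have h1 : 6 + 12 * (1 / (10 * 10 ^ 30) * r) ≤ r := by
      norm_num at h ⊢
      linarith
    have h2 : (6 + 12 * (1 / (10 * 10 ^ 30) * r)) ^ 2 ≤ r ^ 2 :=
      pow_le_pow_left₀ (by positivity) h1 2
    have h3 : (10 ^ 30 : ℝ) * r ^ 2 ≤ r ^ 3 := by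
      rw [pow_succ r 2, mul_comm]
      exact mul_le_mul_of_nonneg_left h.le (by positivity)
    have h4 : r ^ 3 ≤ r ^ 7 := pow_le_pow_right₀ (by linarith) (by norm_num)
    have h5 : 1 ≤ r ^ 2 := one_le_pow₀ (by linarith)
    linarith
end

section
/- For every α ∈ (0, 1/2), ex(α) < 1. -/
open Filter MeasureTheory Pointwise

theorem card_natAbs_valMinAbs_le {p : ℕ} [NeZero p] {T : ℕ} (hT : 2 * T < p) :
    (Finset.univ.filter fun a : ZMod p => a.valMinAbs.natAbs ≤ T).card = 2 * T + 1 := by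
  have key : (Finset.univ.filter fun a : ZMod p => a.valMinAbs.natAbs ≤ T) =
      (Finset.Icc (-(T : ℤ)) T).image (fun b : ℤ => (b : ZMod p)) := by
    ext a
    simp only [Finset.mem_filter, Finset.mem_univ, true_and, Finset.mem_image, Finset.mem_Icc]
    constructor
    · intro h
      exact ⟨a.valMinAbs, by omega, a.coe_valMinAbs⟩
    · rintro ⟨b, hb, rfl⟩
      have : ((b : ZMod p)).valMinAbs = b :=
        (ZMod.valMinAbs_spec _ _).2 ⟨rfl, by constructor <;> omega⟩
      rw [this]; omega
  rw [key, Finset.card_image_of_injOn]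
  · rw [Int.card_Icc]; omega
  · intro b hb c hc h
    simp only [Finset.coe_Icc, Set.mem_Icc] at hb hc
    have h1 : ((b : ZMod p)).valMinAbs = b :=
      (ZMod.valMinAbs_spec _ _).2 ⟨rfl, by constructor <;> omega⟩
    have h2 : ((c : ZMod p)).valMinAbs = c :=
      (ZMod.valMinAbs_spec _ _).2 ⟨rfl, by constructor <;> omega⟩
    have h' : (b : ZMod p) = c := h
    rw [← h1, h', h2]

theorem card_natAbs_valMinAbs_Ioc {p : ℕ} [NeZero p] {T E : ℕ} (hT : 2 * (T + E) < p) :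
    (Finset.univ.filter fun a : ZMod p =>
      T < a.valMinAbs.natAbs ∧ a.valMinAbs.natAbs ≤ T + E).card = 2 * E := by
  have h1 := card_natAbs_valMinAbs_le (p := p) (T := T) (by omega)
  have h2 := card_natAbs_valMinAbs_le (p := p) hT
  have h3 : (Finset.univ.filter fun a : ZMod p => a.valMinAbs.natAbs ≤ T + E) =
      (Finset.univ.filter fun a : ZMod p => a.valMinAbs.natAbs ≤ T) ∪
      (Finset.univ.filter fun a : ZMod p =>
        T < a.valMinAbs.natAbs ∧ a.valMinAbs.natAbs ≤ T + E) := by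
    ext a; simp; omega
  rw [h3, Finset.card_union_of_disjoint, h1] at h2
  · omega
  · rw [Finset.disjoint_left]; intro a; simp; omega

theorem card_valMinAbs_mul_le {p : ℕ} [NeZero p] (T : ℕ) {m : ℕ} (hm : 0 < m) :
    (Finset.univ.filter fun a : ZMod p =>
      a.valMinAbs.natAbs ≤ T ∧ ((m : ZMod p) * a).valMinAbs.natAbs ≤ T).card ≤
      (2 * ((m + 1) * T / p) + 1) * (2 * T / m + 1) := by
  have hp : 0 < p := Nat.pos_of_neZero p
  set L := (m + 1) * T / p with hL
  have key : (Finset.univ.filter fun a : ZMod p =>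
      a.valMinAbs.natAbs ≤ T ∧ ((m : ZMod p) * a).valMinAbs.natAbs ≤ T) ⊆
      (Finset.Icc (-(L : ℤ)) L).biUnion fun l =>
        (Finset.Icc (-(((T : ℤ) - l * p) / m)) (((T : ℤ) + l * p) / m)).image
          (fun b : ℤ => (b : ZMod p)) := by
    intro a ha
    simp only [Finset.mem_filter, Finset.mem_univ, true_and] at ha
    obtain ⟨h1, h2⟩ := ha
    have h3 : ((m * a.valMinAbs - ((m : ZMod p) * a).valMinAbs : ℤ) : ZMod p) = 0 := by
      simp
    obtain ⟨l, hl⟩ := (ZMod.intCast_zmod_eq_zero_iff_dvd _ p).1 h3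
    set b := a.valMinAbs with hb
    set r := ((m : ZMod p) * a).valMinAbs with hr
    have hbT : |b| ≤ T := by rw [Int.abs_eq_natAbs]; exact_mod_cast h1
    have hrT : |r| ≤ T := by rw [Int.abs_eq_natAbs]; exact_mod_cast h2
    have hl' : |l| ≤ (L : ℤ) := by
      have : |l| * p ≤ (m + 1) * T := by
        calc |l| * p = |l * p| := by rw [abs_mul, Nat.abs_cast]
          _ = |m * b - r| := by rw [hl, mul_comm]
          _ ≤ |m * b| + |r| := abs_sub _ _
          _ = m * |b| + |r| := by rw [abs_mul, Nat.abs_cast]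
          _ ≤ m * T + T := by gcongr
          _ = _ := by ring
      rw [hL]; push_cast
      exact (Int.le_ediv_iff_mul_le (by exact_mod_cast hp)).2 this
    simp only [Finset.mem_biUnion, Finset.mem_image, Finset.mem_Icc]
    have hm' : (0 : ℤ) < m := by exact_mod_cast hm
    have hr2 := abs_le.1 hrT
    refine ⟨l, abs_le.1 hl', b, ⟨?_, ?_⟩, a.coe_valMinAbs⟩
    · rw [neg_le, Int.le_ediv_iff_mul_le hm']; linarith
    · rw [Int.le_ediv_iff_mul_le hm']; linarith
  refine (Finset.card_le_card key).trans ?_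
  refine (Finset.card_biUnion_le_card_mul _ _ (2 * T / m + 1) ?_).trans ?_
  · intro l _
    refine Finset.card_image_le.trans ?_
    rw [Int.card_Icc]
    have hm' : (0 : ℤ) < m := by exact_mod_cast hm
    have : ((T : ℤ) + l * p) / m + (((T : ℤ) - l * p) / m) ≤ ((2 * T / m : ℕ) : ℤ) := by
      push_cast
      rw [Int.le_ediv_iff_mul_le hm', add_mul]
      have h1 := Int.ediv_mul_le ((T : ℤ) + l * p) hm'.ne'
      have h2 := Int.ediv_mul_le ((T : ℤ) - l * p) hm'.ne'
      linarith
    generalize 2 * T / m = k at this ⊢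
    omega
  · rw [Int.card_Icc]
    apply Nat.mul_le_mul_right
    omega

theorem card_avoiding_mul_le {X : Type*} [Fintype X] [DecidableEq X] {n m : ℕ} {J : ℝ} (hJ0 : 0 ≤ J)
    (M : ℕ → Finset X) (hM : ∀ i < n, (M i).card = m)
    (hJ : ∀ i < n, ∀ j < n, i ≠ j → ((M i ∩ M j).card : ℝ) ≤ J) :
    ((Finset.univ.filter fun a => ∀ i < n, a ∉ M i).card : ℝ) * (n * m) ^ 2 ≤
      (Fintype.card X : ℝ) ^ 2 * (n * m + n ^ 2 * J) - Fintype.card X * (n * m) ^ 2 := by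
  set q := (Fintype.card X : ℝ)
  let f : X → ℝ := fun a => ∑ i ∈ Finset.range n, if a ∈ M i then 1 else 0
  have hf1 : ∑ a, f a = n * m := by
    simp only [f]
    rw [Finset.sum_comm, Finset.sum_congr rfl (g := fun _ => (m : ℝ))]
    · simp
    · intro i hi
      simp [hM i (Finset.mem_range.1 hi)]
  have hf2 : ∑ a, f a ^ 2 ≤ n * m + n ^ 2 * J := by
    have h1 : ∑ a, f a ^ 2 = ∑ i ∈ Finset.range n, ∑ j ∈ Finset.range n,
        ((M i ∩ M j).card : ℝ) := by
      simp only [f, sq, Finset.sum_mul_sum]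
      rw [Finset.sum_comm]
      refine Finset.sum_congr rfl fun i _ => ?_
      rw [Finset.sum_comm]
      refine Finset.sum_congr rfl fun j _ => ?_
      simp [← ite_and, ← Finset.mem_inter, Finset.inter_comm]
    rw [h1]
    have h2 : ∀ i ∈ Finset.range n, ∑ j ∈ Finset.range n, ((M i ∩ M j).card : ℝ) ≤ m + n * J := by
      intro i hi
      calc ∑ j ∈ Finset.range n, ((M i ∩ M j).card : ℝ)
          ≤ ∑ j ∈ Finset.range n, ((if i = j then (m : ℝ) else 0) + J) := by
            refine Finset.sum_le_sum fun j hj => ?_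
            split_ifs with h
            · subst h
              rw [Finset.inter_self, hM i (Finset.mem_range.1 hi)]
              simpa using hJ0
            · rw [zero_add]
              exact hJ i (Finset.mem_range.1 hi) j (Finset.mem_range.1 hj) h
        _ = m + n * J := by
            rw [Finset.sum_add_distrib, Finset.sum_ite_eq, if_pos hi]; simp
    calc _ ≤ ∑ i ∈ Finset.range n, ((m : ℝ) + n * J) := Finset.sum_le_sum h2
      _ = _ := by simp; ring
  have h3 : ((Finset.univ.filter fun a => ∀ i < n, a ∉ M i).card : ℝ) * (n * m) ^ 2 ≤
      ∑ a, (q * f a - n * m) ^ 2 := by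
    rw [← nsmul_eq_mul, ← Finset.sum_const]
    calc _ = ∑ a ∈ Finset.univ.filter fun a => ∀ i < n, a ∉ M i, (q * f a - n * m) ^ 2 := by
          refine Finset.sum_congr rfl fun a ha => ?_
          have : f a = 0 := Finset.sum_eq_zero fun i hi =>
            if_neg ((Finset.mem_filter.1 ha).2 i (Finset.mem_range.1 hi))
          rw [this]; ring
      _ ≤ _ := Finset.sum_le_sum_of_subset_of_nonneg (Finset.filter_subset _ _)
          fun _ _ _ => sq_nonneg _
  have h4 : ∑ a, (q * f a - n * m) ^ 2 =
      q ^ 2 * ∑ a, f a ^ 2 - 2 * q * (n * m) * ∑ a, f a + q * (n * m) ^ 2 := by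
    rw [Finset.mul_sum, Finset.mul_sum, ← Finset.sum_sub_distrib]
    have : q * (n * m : ℝ) ^ 2 = ∑ _a : X, (n * m : ℝ) ^ 2 := by simp [q]
    rw [this, ← Finset.sum_add_distrib]
    exact Finset.sum_congr rfl fun a _ => by ring
  rw [h4, hf1] at h3
  have : q ^ 2 * ∑ a, f a ^ 2 ≤ q ^ 2 * (n * m + n ^ 2 * J) := by gcongr
  linarith

theorem card_filter_mul_left {F : Type*} [Field F] [Fintype F] (P : F → Prop)
    [DecidablePred P] {v : F} (hv : v ≠ 0) :
    (Finset.univ.filter fun a => P (v * a)).card = (Finset.univ.filter P).card :=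
  Finset.card_equiv (Equiv.mulLeft₀ v hv) fun a => by simp

/-- The points `a` whose orbit under multiplication by `u` first enters `[-T, T]` at an odd time
below `2 * h`, staying outside `[-(T + E), T + E]` before. -/
def oddEntry {p : ℕ} (u : ZMod p) (T E h : ℕ) [NeZero p] : Finset (ZMod p) :=
  Finset.univ.filter fun a => ∃ j < h, (u ^ (2 * j + 1) * a).valMinAbs.natAbs ≤ T ∧
    ∀ i < 2 * j + 1, T + E < (u ^ i * a).valMinAbs.natAbs

theorem exists_lt_natAbs_valMinAbs_of_mem_oddEntry {p : ℕ} [NeZero p] {u : ZMod p} {T E h : ℕ}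
    {a b : ZMod p} (ha : a ∈ oddEntry u T E h) (hb : b ∈ oddEntry u T E h) :
    ∃ i < 2 * h, E < (u ^ i * (a + u * b)).valMinAbs.natAbs := by
  by_contra! hc
  simp only [oddEntry, Finset.mem_filter, Finset.mem_univ, true_and] at ha hb
  obtain ⟨j, hj, h1, h2⟩ := ha
  obtain ⟨k, hk, h3, h4⟩ := hb
  have hab : ∀ i < 2 * h, (u ^ i * a).valMinAbs.natAbs ≤
      E + (u ^ (i + 1) * b).valMinAbs.natAbs := by
    intro i hi
    have := ZMod.natAbs_valMinAbs_add_le (u ^ i * (a + u * b)) (-(u ^ (i + 1) * b))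
    have e : u ^ i * (a + u * b) + -(u ^ (i + 1) * b) = u ^ i * a := by ring
    rw [e] at this
    exact this.trans ((Int.natAbs_add_le _ _).trans (by
      rw [ZMod.natAbs_valMinAbs_neg]; exact Nat.add_le_add_right (hc i hi) _))
  have hba : ∀ i < 2 * h, (u ^ (i + 1) * b).valMinAbs.natAbs ≤
      E + (u ^ i * a).valMinAbs.natAbs := by
    intro i hi
    have := ZMod.natAbs_valMinAbs_add_le (u ^ i * (a + u * b)) (-(u ^ i * a))
    have e : u ^ i * (a + u * b) + -(u ^ i * a) = u ^ (i + 1) * b := by ring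
    rw [e] at this
    exact this.trans ((Int.natAbs_add_le _ _).trans (by
      rw [ZMod.natAbs_valMinAbs_neg]; exact Nat.add_le_add_right (hc i hi) _))
  rcases lt_or_ge (2 * j + 2) (2 * k + 1) with hlt | hge
  · have := h4 _ hlt
    have := hba (2 * j + 1) (by omega)
    rw [show 2 * j + 1 + 1 = 2 * j + 2 from rfl] at this
    omega
  · have := h2 (2 * k) (by omega)
    have := hab (2 * k) (by omega)
    omega

theorem card_le_oddEntry {p : ℕ} [Fact p.Prime] {u : ZMod p} (hu : u ≠ 0) {T E : ℕ} (h : ℕ)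
    (hT : 2 * (T + E) < p) :
    p ≤ (Finset.univ.filter fun a : ZMod p =>
        ∀ i < 2 * h, T < (u ^ i * a).valMinAbs.natAbs).card + (2 * T + 1) +
      2 * ((oddEntry u T E h).card + 2 * h * (2 * E)) := by
  set A₀ := Finset.univ.filter fun a : ZMod p => ∃ j < h,
    (u ^ (2 * j + 1) * a).valMinAbs.natAbs ≤ T ∧
      ∀ i < 2 * j + 1, T < (u ^ i * a).valMinAbs.natAbs with hA₀
  set G := Finset.univ.filter fun a : ZMod p => u * a ∈ A₀ with hG
  have hGc : G.card = A₀.card := by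
    rw [hG, card_filter_mul_left (fun a => a ∈ A₀) hu, Finset.filter_univ_mem]
  have hA : A₀.card ≤ (oddEntry u T E h).card + 2 * h * (2 * E) := by
    have hsub : A₀ ⊆ oddEntry u T E h ∪ (Finset.range (2 * h)).biUnion fun i =>
        Finset.univ.filter fun a : ZMod p => T < (u ^ i * a).valMinAbs.natAbs ∧
          (u ^ i * a).valMinAbs.natAbs ≤ T + E := by
      intro a ha
      simp only [hA₀, Finset.mem_filter, Finset.mem_univ, true_and] at ha
      obtain ⟨j, hj, h1, h2⟩ := ha
      simp only [oddEntry, Finset.mem_union, Finset.mem_filter, Finset.mem_univ, true_and,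
        Finset.mem_biUnion, Finset.mem_range]
      by_cases hb : ∀ i < 2 * j + 1, T + E < (u ^ i * a).valMinAbs.natAbs
      · exact Or.inl ⟨j, hj, h1, hb⟩
      · push Not at hb
        obtain ⟨i, hi, hi'⟩ := hb
        exact Or.inr ⟨i, by omega, h2 i hi, hi'⟩
    refine (Finset.card_le_card hsub).trans ((Finset.card_union_le _ _).trans ?_)
    gcongr
    refine (Finset.card_biUnion_le_card_mul _ _ (2 * E) ?_).trans (by simp)
    intro i _
    rw [card_filter_mul_left (fun b : ZMod p => T < b.valMinAbs.natAbs ∧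
      b.valMinAbs.natAbs ≤ T + E) (pow_ne_zero i hu), card_natAbs_valMinAbs_Ioc hT]
  have hM := card_natAbs_valMinAbs_le (p := p) (T := T) (by omega)
  set B := Finset.univ.filter fun a : ZMod p =>
    ∀ i < 2 * h, T < (u ^ i * a).valMinAbs.natAbs with hB
  set M := Finset.univ.filter fun a : ZMod p => a.valMinAbs.natAbs ≤ T with hM'
  have hcover : (Finset.univ : Finset (ZMod p)) ⊆ B ∪ M ∪ (A₀ ∪ G) := by
    intro a _
    by_cases hab : a ∈ B
    · simp [hab]
    have hex : ∃ i, i < 2 * h ∧ (u ^ i * a).valMinAbs.natAbs ≤ T := by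
      simpa [hB] using hab
    classical
    obtain ⟨ht, htT⟩ := Nat.find_spec hex
    have hmin : ∀ i < Nat.find hex, T < (u ^ i * a).valMinAbs.natAbs := by
      intro i hi
      have := Nat.find_min hex hi
      by_contra! hcon
      exact this ⟨hi.trans ht, hcon⟩
    generalize Nat.find hex = t at ht htT hmin
    simp only [Finset.mem_union]
    rcases Nat.even_or_odd' t with ⟨k, rfl | rfl⟩
    · rcases k with _ | k
      · left; right
        simpa [hM'] using htT
      · right; right
        simp only [hG, hA₀, Finset.mem_filter, Finset.mem_univ, true_and]
        refine ⟨k, by omega, ?_, fun i hi => ?_⟩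
        · rw [← mul_assoc, ← pow_succ]; exact htT
        · rw [← mul_assoc, ← pow_succ]; exact hmin _ (by omega)
    · right; left
      simp only [hA₀, Finset.mem_filter, Finset.mem_univ, true_and]
      exact ⟨k, by omega, htT, hmin⟩
  have h1 := Finset.card_le_card hcover
  rw [Finset.card_univ, ZMod.card] at h1
  have h2 := Finset.card_union_le (B ∪ M) (A₀ ∪ G)
  have h3 := Finset.card_union_le B M
  have h4 := Finset.card_union_le A₀ G
  omega

theorem le_card_forall_natAbs_valMinAbs_le {p : ℕ} [NeZero p] (u : ZMod p) (n : ℕ) {E K : ℕ}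
    (hK : p < K * E) :
    (p : ℝ) / K ^ n ≤ ((Finset.univ.filter fun c : ZMod p =>
      ∀ i < n, (u ^ i * c).valMinAbs.natAbs ≤ E).card : ℝ) := by
  have hp : 0 < p := Nat.pos_of_neZero p
  have hE : 0 < E := Nat.pos_of_ne_zero (by rintro rfl; simp at hK)
  have hK0 : 0 < K := Nat.pos_of_ne_zero (by rintro rfl; simp at hK)
  have : NeZero K := ⟨hK0.ne'⟩
  let f : ZMod p → (Fin n → Fin K) := fun a i =>
    ⟨(u ^ (i : ℕ) * a).val / E, by
      rw [Nat.div_lt_iff_lt_mul hE]; exact (ZMod.val_lt _).trans hK⟩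
  obtain ⟨y, hy⟩ := Fintype.exists_le_card_fiber_of_nsmul_le_card (b := (p : ℝ) / K ^ n) f (by
    simp only [Fintype.card_pi, Fintype.card_fin, Finset.prod_const, Finset.card_univ, ZMod.card,
      nsmul_eq_mul]
    push_cast
    rw [mul_div_cancel₀]
    positivity)
  refine hy.trans ?_
  have hpos : 0 < (p : ℝ) / K ^ n := by positivity
  obtain ⟨a₀, ha₀⟩ : (Finset.univ.filter fun x => f x = y).Nonempty := by
    rw [← Finset.card_pos]; exact_mod_cast hpos.trans_le hy
  norm_cast
  refine Finset.card_le_card_of_injOn (fun a => a - a₀) ?_ (fun a _ b _ hab => by simpa using hab)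
  intro a ha
  simp only [Finset.coe_filter, Finset.mem_univ, true_and, Set.mem_ofPred_eq,
    Finset.mem_filter] at ha ha₀ ⊢
  intro i hi
  have h1 : (u ^ i * a).val / E = (u ^ i * a₀).val / E := by
    have := congrFun (ha.trans ha₀.symm) ⟨i, hi⟩
    simpa [f] using this
  have h2 : (((u ^ i * (a - a₀)).valMinAbs : ℤ) : ZMod p) =
      (((u ^ i * a).val - (u ^ i * a₀).val : ℤ) : ZMod p) := by
    simp [mul_sub]
  have h3 := ZMod.natAbs_min_of_le_div_two p _ _ h2 (ZMod.natAbs_valMinAbs_le _)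
  refine h3.trans ?_
  have h4 := Nat.div_add_mod (u ^ i * a).val E
  have h5 := Nat.div_add_mod (u ^ i * a₀).val E
  rw [h1] at h4
  have h6 := Nat.mod_lt (u ^ i * a).val hE
  have h7 := Nat.mod_lt (u ^ i * a₀).val hE
  omega

theorem exZMod_nonneg (p : ℕ) (lam : ℤ) (α : ℝ) : 0 ≤ exZMod p lam α := by
  refine Real.sInf_nonneg ?_
  rintro x ⟨A, -, rfl⟩
  positivity

theorem exZMod_le {p : ℕ} [Fact p.Prime] {lam : ℤ} {α : ℝ} {T E h K : ℕ} (hK : p < K * E)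
    (hα : α * p ≤ (oddEntry (lam : ZMod p) T E h).card) :
    exZMod p lam α ≤ 1 - 1 / K ^ (2 * h) := by
  have hp : (0 : ℝ) < p := by exact_mod_cast (Fact.out : p.Prime).pos
  set A := oddEntry (lam : ZMod p) T E h with hA
  set C := Finset.univ.filter fun c : ZMod p =>
      ∀ i < 2 * h, ((lam : ZMod p) ^ i * c).valMinAbs.natAbs ≤ E with hC
  have hCc := le_card_forall_natAbs_valMinAbs_le (lam : ZMod p) (2 * h) hK
  have hdis : Disjoint (A + A.image fun a => (lam : ZMod p) * a) C := by
    rw [Finset.disjoint_left]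
    intro c hc hcC
    obtain ⟨a, ha, b', hb', rfl⟩ := Finset.mem_add.1 hc
    obtain ⟨b, hb, rfl⟩ := Finset.mem_image.1 hb'
    obtain ⟨i, hi, hi'⟩ := exists_lt_natAbs_valMinAbs_of_mem_oddEntry ha hb
    have := (Finset.mem_filter.1 hcC).2 i hi
    omega
  have hle : (A + A.image fun a => (lam : ZMod p) * a).card + C.card ≤ p := by
    rw [← Finset.card_union_of_disjoint hdis]
    exact (Finset.card_le_univ _).trans (by rw [ZMod.card])
  have hle' : (((A + A.image fun a => (lam : ZMod p) * a).card : ℝ)) + C.card ≤ p := by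
    exact_mod_cast hle
  have hinf : exZMod p lam α ≤ ((A + A.image fun a => (lam : ZMod p) * a).card : ℝ) / p := by
    refine csInf_le ⟨0, ?_⟩ ⟨A, hα, rfl⟩
    rintro x ⟨A, -, rfl⟩
    exact div_nonneg (Nat.cast_nonneg _) hp.le
  refine hinf.trans ?_
  rw [div_le_iff₀ hp, sub_mul, one_mul, one_div_mul_eq_div]
  exact (le_sub_iff_add_le.2 hle').trans (sub_le_sub_left hCc _)

theorem card_inter_le {p : ℕ} [Fact p.Prime] {L T n : ℕ} (hL : 1 ≤ L)
    (hu : (L : ZMod p) ≠ 0) {δ : ℝ} (hδ : 0 ≤ δ)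
    (h1 : (2 * T + 1 : ℝ) + p ≤ δ * L * (2 * T + 1)) (h2 : (L : ℝ) ^ n ≤ δ * (2 * T + 1))
    {i j : ℕ} (hi : i < n) (hj : j < n) (hij : i ≠ j) :
    (((Finset.univ.filter fun a : ZMod p => ((L : ZMod p) ^ i * a).valMinAbs.natAbs ≤ T) ∩
      (Finset.univ.filter fun a : ZMod p =>
        ((L : ZMod p) ^ j * a).valMinAbs.natAbs ≤ T)).card : ℝ) ≤
      (1 + δ) ^ 2 * (2 * T + 1) ^ 2 / p := by
  wlog hlt : i < j generalizing i j
  · rw [Finset.inter_comm]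
    exact this hj hi hij.symm (by omega)
  obtain ⟨k, rfl⟩ := Nat.exists_eq_add_of_lt hlt
  have hp : (0 : ℝ) < p := by exact_mod_cast (Fact.out : p.Prime).pos
  have hL' : (1 : ℝ) ≤ L := by exact_mod_cast hL
  have hcard : ((Finset.univ.filter fun a : ZMod p =>
      ((L : ZMod p) ^ i * a).valMinAbs.natAbs ≤ T) ∩
      (Finset.univ.filter fun a : ZMod p =>
        ((L : ZMod p) ^ (i + k + 1) * a).valMinAbs.natAbs ≤ T)).card =
      (Finset.univ.filter fun b : ZMod p => b.valMinAbs.natAbs ≤ T ∧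
        (((L ^ (k + 1) : ℕ) : ZMod p) * b).valMinAbs.natAbs ≤ T).card := by
    rw [← card_filter_mul_left (fun b : ZMod p => b.valMinAbs.natAbs ≤ T ∧
        (((L ^ (k + 1) : ℕ) : ZMod p) * b).valMinAbs.natAbs ≤ T) (pow_ne_zero i hu),
      ← Finset.filter_and]
    congr 1
    refine Finset.filter_congr fun a _ => ?_
    rw [← mul_assoc, Nat.cast_pow, ← pow_add, show k + 1 + i = i + k + 1 by ring]
  rw [hcard]
  set m := L ^ (k + 1) with hm
  have hm0 : 0 < m := by positivity
  have hm0' : (0 : ℝ) < m := by exact_mod_cast hm0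
  have hLm : (L : ℝ) ≤ m := by rw [hm]; push_cast; exact le_self_pow₀ hL' (by omega)
  have hmn : (m : ℝ) ≤ (L : ℝ) ^ n := by
    rw [hm]; push_cast; exact pow_le_pow_right₀ hL' (by omega)
  have h3 := card_valMinAbs_mul_le (p := p) T hm0
  have h4 : ((2 * ((m + 1) * T / p) + 1 : ℕ) : ℝ) ≤ 2 * ((m + 1) * T / p) + 1 := by
    have : (((m + 1) * T / p : ℕ) : ℝ) ≤ ((m + 1) * T : ℕ) / p := Nat.cast_div_le
    push_cast at this ⊢
    linarith
  have h5 : ((2 * T / m + 1 : ℕ) : ℝ) ≤ 2 * T / m + 1 := by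
    have : ((2 * T / m : ℕ) : ℝ) ≤ (2 * T : ℕ) / m := Nat.cast_div_le
    push_cast at this ⊢
    linarith
  have hT : (0 : ℝ) ≤ T := T.cast_nonneg
  have h6 : (2 * ((m + 1) * T / p) + 1 : ℝ) ≤ (1 + δ) * m * (2 * T + 1) / p := by
    rw [le_div_iff₀ hp]
    have e : (2 * ((m + 1) * T / p) + 1 : ℝ) * p = 2 * (m + 1) * T + p := by field_simp
    have : δ * L * (2 * T + 1) ≤ δ * m * (2 * T + 1) := by gcongr
    nlinarith
  have h7 : (2 * T / m + 1 : ℝ) ≤ (1 + δ) * (2 * T + 1) / m := by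
    rw [le_div_iff₀ hm0', add_mul, div_mul_cancel₀ _ hm0'.ne']
    nlinarith
  calc _ ≤ (((2 * ((m + 1) * T / p) + 1) * (2 * T / m + 1) : ℕ) : ℝ) := by exact_mod_cast h3
    _ ≤ ((1 + δ) * m * (2 * T + 1) / p) * ((1 + δ) * (2 * T + 1) / m) := by
      rw [Nat.cast_mul]
      exact mul_le_mul (h4.trans h6) (h5.trans h7) (by positivity) (by positivity)
    _ = _ := by field_simp

theorem card_forall_lt_le {p : ℕ} [Fact p.Prime] {L T n : ℕ} (hL : 1 ≤ L)
    (hu : (L : ZMod p) ≠ 0) {δ : ℝ} (hδ : 0 ≤ δ) (hδ1 : δ ≤ 1) (hT : 2 * T < p)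
    (h1 : (2 * T + 1 : ℝ) + p ≤ δ * L * (2 * T + 1)) (h2 : (L : ℝ) ^ n ≤ δ * (2 * T + 1))
    (h3 : (p : ℝ) ≤ δ * (n * (2 * T + 1))) :
    ((Finset.univ.filter fun a : ZMod p =>
      ∀ i < n, T < ((L : ZMod p) ^ i * a).valMinAbs.natAbs).card : ℝ) ≤ 4 * δ * p := by
  have hp : (0 : ℝ) < p := by exact_mod_cast (Fact.out : p.Prime).pos
  have hn : (0 : ℝ) < n := by
    rcases Nat.eq_zero_or_pos n with rfl | h
    · simp at h3; linarith
    · exact_mod_cast h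
  have key := card_avoiding_mul_le (n := n) (m := 2 * T + 1)
    (J := (1 + δ) ^ 2 * (2 * T + 1) ^ 2 / p) (by positivity)
    (fun i => Finset.univ.filter fun a : ZMod p => ((L : ZMod p) ^ i * a).valMinAbs.natAbs ≤ T)
    (fun i _ => by
      rw [card_filter_mul_left (fun a : ZMod p => a.valMinAbs.natAbs ≤ T) (pow_ne_zero i hu),
        card_natAbs_valMinAbs_le hT])
    (fun i hi j hj hij => card_inter_le hL hu hδ h1 h2 hi hj hij)
  simp only [Finset.mem_filter, Finset.mem_univ, true_and, not_le, ZMod.card] at key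
  push_cast at key
  set N : ℝ := n * (2 * T + 1) with hN
  have hN0 : 0 < N := by positivity
  refine le_of_mul_le_mul_right (key.trans ?_) (by positivity : 0 < N ^ 2)
  have e : (p : ℝ) ^ 2 * (N + n ^ 2 * ((1 + δ) ^ 2 * (2 * T + 1) ^ 2 / p)) - p * N ^ 2 =
      p * (p * N + (1 + δ) ^ 2 * N ^ 2 - N ^ 2) := by
    rw [hN]; field_simp
  rw [e, show 4 * δ * p * N ^ 2 = p * (4 * δ * N ^ 2) by ring]
  have : p * N ≤ δ * N * N := by gcongr
  have : δ ^ 2 * N ^ 2 ≤ δ * N ^ 2 := by gcongr; nlinarith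
  gcongr
  nlinarith

theorem exists_exZMod_le {α : ℝ} (hα0 : 0 < α) (hα : α < 1 / 2) :
    ∃ c < (1 : ℝ), ∀ᶠ lam : ℤ in atTop, ∀ᶠ p : ℕ in atTop, p.Prime → exZMod p lam α ≤ c := by
  set ε := 1 / 2 - α with hε
  have hε0 : 0 < ε := by linarith
  have hε1 : ε < 1 / 2 := by linarith
  obtain ⟨h, hh⟩ := exists_nat_ge (64 / ε ^ 2)
  have hh0 : (0 : ℝ) < h := lt_of_lt_of_le (by positivity) hh
  set τ := ε / 8 with hτ
  set δ := ε / 8 with hδ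
  set η := ε / (8 * h) with hη
  have hη0 : 0 < η := by positivity
  have hτ0 : 0 < τ := by positivity
  obtain ⟨K, hK⟩ := exists_nat_gt (2 / η)
  have hK0 : (0 : ℝ) < K := lt_trans (by positivity) hK
  refine ⟨1 - 1 / K ^ (2 * h), by linarith [show (0 : ℝ) < 1 / K ^ (2 * h) by positivity], ?_⟩
  obtain ⟨L₀, hL₀⟩ := exists_nat_ge ((1 + 1 / τ) / δ)
  filter_upwards [eventually_ge_atTop (L₀ : ℤ), eventually_ge_atTop 1] with lam hlam hlam1
  obtain ⟨L, rfl⟩ := Int.eq_ofNat_of_zero_le (show 0 ≤ lam by omega)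
  have hL1 : 1 ≤ L := by omega
  have hL : (1 + 1 / τ) / δ ≤ L := hL₀.trans (by exact_mod_cast hlam)
  obtain ⟨p₀, hp₀⟩ := exists_nat_ge (L + 4 / ε + 2 / η + L ^ (2 * h) / (δ * τ) + 1 / τ)
  filter_upwards [eventually_gt_atTop p₀] with p hp hpp
  have : Fact p.Prime := ⟨hpp⟩
  have hp' : (L + 4 / ε + 2 / η + L ^ (2 * h) / (δ * τ) + 1 / τ : ℝ) < p :=
    hp₀.trans_lt (by exact_mod_cast hp)
  have hpos : (0 : ℝ) < p := by exact_mod_cast hpp.pos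
  have a1 : (0 : ℝ) < 4 / ε := by positivity
  have a2 : (0 : ℝ) < 2 / η := by positivity
  have a3 : (0 : ℝ) ≤ L ^ (2 * h) / (δ * τ) := by positivity
  have a4 : (0 : ℝ) < 1 / τ := by positivity
  have a5 : (0 : ℝ) ≤ L := by positivity
  have b0 : (L : ℝ) < p := by linarith
  have b1 : 4 < ε * p := by
    have : 4 / ε < p := by linarith
    rwa [div_lt_iff₀' hε0] at this
  have b2 : 2 < η * p := by
    have : 2 / η < p := by linarith
    rwa [div_lt_iff₀' hη0] at this
  have b3 : (L : ℝ) ^ (2 * h) ≤ δ * (τ * p) := by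
    have : L ^ (2 * h) / (δ * τ) ≤ (p : ℝ) := by linarith
    rwa [div_le_iff₀' (by positivity), mul_assoc] at this
  have b4 : 1 < τ * p := by
    have : 1 / τ < p := by linarith
    rwa [div_lt_iff₀' hτ0] at this
  have hu : (L : ZMod p) ≠ 0 := by
    rw [Ne, ZMod.natCast_eq_zero_iff]
    intro hd
    have := Nat.le_of_dvd (by omega) hd
    have : L < p := by exact_mod_cast b0
    omega
  set T := ⌊τ * p⌋₊ with hT
  set E := ⌊η * p⌋₊ with hE
  have c1 : (T : ℝ) ≤ τ * p := Nat.floor_le (by positivity)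
  have c2 : τ * p < T + 1 := Nat.lt_floor_add_one _
  have c3 : (E : ℝ) ≤ η * p := Nat.floor_le (by positivity)
  have c4 : η * p < E + 1 := Nat.lt_floor_add_one _
  have hhη : 8 * h * η = ε := by rw [hη]; field_simp
  have hh1 : (1 : ℝ) ≤ h := by
    have : 0 < h := by exact_mod_cast hh0
    exact_mod_cast this
  have hη1 : 8 * η ≤ ε := by
    rw [← hhη]
    have : 8 * 1 * η ≤ 8 * h * η := by gcongr
    linarith
  have hS : τ * p ≤ 2 * T + 1 := by linarith
  have hTE : 2 * (T + E) < p := by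
    have : (2 * (T + E) : ℝ) < p := by
      have t1 : 8 * η * p ≤ ε * p := by gcongr
      have t2 : ε * p < 1 / 2 * p := by gcongr
      have t3 : τ * p = ε * p / 8 := by rw [hτ]; ring
      linarith
    exact_mod_cast this
  have hKE : p < K * E := by
    have : (p : ℝ) < K * E := by
      have k1 : 2 < K * η := by rwa [div_lt_iff₀ hη0] at hK
      have k2 : η * p ≤ 2 * E := by linarith
      have k3 : K * (η * p) ≤ K * (2 * E) := by gcongr
      have k4 : 2 * p < K * η * p := by gcongr
      linarith
    exact_mod_cast this
  have hB := card_forall_lt_le (p := p) (L := L) (T := T) (n := 2 * h) (δ := δ) hL1 hu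
    (by positivity) (by linarith) (by omega)
    (by
      have d1 : 1 + 1 / τ ≤ δ * L := by rwa [div_le_iff₀' (by positivity)] at hL
      have d2 : (p : ℝ) ≤ 1 / τ * (2 * T + 1) := by
        rw [one_div_mul_eq_div, le_div_iff₀' hτ0]; exact hS
      have : (1 + 1 / τ) * (2 * T + 1) ≤ δ * L * (2 * T + 1) := by gcongr
      linarith)
    (b3.trans (by gcongr))
    (by
      have d1 : 64 ≤ h * ε ^ 2 := by rwa [div_le_iff₀ (by positivity)] at hh
      have : δ * (((2 * h : ℕ) : ℝ) * (τ * p)) ≤ δ * (((2 * h : ℕ) : ℝ) * (2 * T + 1)) := by gcongr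
      refine le_trans ?_ this
      have e : δ * (((2 * h : ℕ) : ℝ) * (τ * p)) = (h * ε ^ 2) * p / 32 := by
        rw [hδ, hτ]; push_cast; ring
      rw [e]
      have d2 : 64 * p ≤ h * ε ^ 2 * p := by gcongr
      linarith)
  have hmain := card_le_oddEntry (p := p) hu h hTE
  refine exZMod_le (T := T) hKE ?_
  rw [Int.cast_natCast]
  have hmain' : (p : ℝ) ≤ (Finset.univ.filter fun a : ZMod p =>
        ∀ i < 2 * h, T < ((L : ZMod p) ^ i * a).valMinAbs.natAbs).card + (2 * T + 1) +
      2 * ((oddEntry (L : ZMod p) T E h).card + 2 * h * (2 * E)) := by exact_mod_cast hmain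
  have e1 : (h : ℝ) * E ≤ h * (η * p) := by gcongr
  have e2 : 8 * (h * (η * p)) = ε * p := by rw [← hhη]; ring
  have e3 : α * p = p / 2 - ε * p := by rw [hε]; ring
  rw [e3]
  have e4 : 4 * δ * p = ε * p / 2 := by rw [hδ]; ring
  have e5 : τ * p = ε * p / 8 := by rw [hτ]; ring
  linarith

/-- For every `α ∈ (0, 1/2)`, `ex(α) < 1`. -/
theorem exD_lt_one :
    ∀ α : ℝ, 0 < α → α < 1 / 2 → exD α < 1 := by
  intro α hα0 hα
  obtain ⟨c, hc, hev⟩ := exists_exZMod_le hα0 hα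
  have hne : (atTop ⊓ 𝓟 {p : ℕ | p.Prime}).NeBot :=
    Filter.inf_principal_neBot_iff.2 fun U hU => by
      obtain ⟨N, hN⟩ := Filter.mem_atTop_sets.1 hU
      obtain ⟨p, hp, hpp⟩ := Nat.exists_infinite_primes N
      exact ⟨p, hN p hp, hpp⟩
  have hbd : ∀ᶠ lam : ℤ in atTop, ∀ᶠ p in atTop ⊓ 𝓟 {p : ℕ | p.Prime}, exZMod p lam α ≤ c :=
    hev.mono fun lam h => Filter.eventually_inf_principal.2 h
  refine lt_of_le_of_lt (limsup_le_of_le ?_ ?_) hc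
  · refine isCoboundedUnder_le_of_eventually_le (x := 0) _ ?_
    filter_upwards [hbd] with lam h
    exact le_limsup_of_frequently_le
      (Frequently.of_forall fun p => exZMod_nonneg p lam α) ⟨c, h⟩
  · filter_upwards [hbd] with lam h
    exact limsup_le_of_le
      (isCoboundedUnder_le_of_le _ (x := 0) fun p => exZMod_nonneg p lam α) h
end

section
/- For every α ∈ (0, 1/2), ex_T(α) < 1. -/
open Filter MeasureTheory Pointwise

abbrev 𝕋 : Type := AddCircle (1 : ℝ)

/-- Projection `𝕋^{n+1} → 𝕋^n` forgetting the first coordinate. -/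
def projFirst (n : ℕ) (x : Fin (n + 1) → 𝕋) (i : Fin n) : 𝕋 := x i.succ

/-- Projection `𝕋^{n+1} → 𝕋^n` forgetting the last coordinate. -/
def projLast (n : ℕ) (x : Fin (n + 1) → 𝕋) (i : Fin n) : 𝕋 := x i.castSucc

/-- Auxiliary: `exTdim m α` is the infimum of `μ(π₁(B) + π_{m+1}(B))` over open sets
`B ⊆ 𝕋^{m+1}` with `μ(B) > α`. -/
noncomputable def exTdim (m : ℕ) (α : ℝ) : ℝ :=
  sInf {x : ℝ | ∃ B : Set (Fin (m + 1) → 𝕋), IsOpen B ∧ α < (volume B).toReal ∧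
    x = (volume (projFirst m '' B + projLast m '' B)).toReal}

/-- `exT n α` is the paper's `ex_T(n, α)`, meaningful for `n ≥ 2`. -/
noncomputable def exT (n : ℕ) (α : ℝ) : ℝ := exTdim (n - 1) α

/-- `exT(α) = lim_{n→∞} ex_T(n, α)`; since `ex_T(n, α)` is non-increasing in `n` and
bounded below, this limit equals the infimum. -/
noncomputable def exTlim (α : ℝ) : ℝ := ⨅ n : ℕ, exT (n + 2) α


instance isProbabilityMeasure_volume_circle : IsProbabilityMeasure (volume : Measure 𝕋) :=
  ⟨by simp [AddCircle.measure_univ]⟩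

instance nullSingletonClass_volume_circle : NullSingletonClass (volume : Measure 𝕋) :=
  ⟨fun x => by simpa using AddCircle.volume_closedBall (T := 1) (x := x) 0⟩

/-- The points of `𝕋^n` whose `j`-th coordinate is farther from `0` than every other coordinate,
by a margin larger than `δ`. -/
def peakSet (n : ℕ) (δ : ℝ) (j : Fin n) : Set (Fin n → 𝕋) :=
  {x | ∀ i, i ≠ j → ‖x i‖ + δ < ‖x j‖}

theorem isOpen_peakSet (n : ℕ) (δ : ℝ) (j : Fin n) : IsOpen (peakSet n δ j) := by
  simp only [peakSet, Set.ofPred_forall]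
  refine isOpen_iInter_of_finite fun i => isOpen_iInter_of_finite fun _ => ?_
  exact isOpen_lt (by fun_prop) (by fun_prop)

theorem peakSet_disjoint {n : ℕ} {δ : ℝ} (hδ : 0 ≤ δ) {i j : Fin n} (hij : i ≠ j) :
    Disjoint (peakSet n δ i) (peakSet n δ j) := by
  refine Set.disjoint_left.2 fun x hi hj => ?_
  have h₁ := hi j hij.symm
  have h₂ := hj i hij
  linarith

theorem volume_peakSet_eq (n : ℕ) (δ : ℝ) (i j : Fin n) :
    volume (peakSet n δ i) = volume (peakSet n δ j) := by
  have h := (volume_measurePreserving_piCongrLeft (fun _ : Fin n => 𝕋)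
    (Equiv.swap i j)).measure_preimage (isOpen_peakSet n δ i).measurableSet.nullMeasurableSet
  rw [← h]
  congr 1
  ext x
  have hx : ∀ l, MeasurableEquiv.piCongrLeft (fun _ : Fin n => 𝕋) (Equiv.swap i j) x l
      = x (Equiv.swap i j l) := by
    intro l
    have := MeasurableEquiv.piCongrLeft_apply_apply (β := fun _ : Fin n => 𝕋)
      (Equiv.swap i j) x (Equiv.swap i j l)
    simpa using this
  simp only [peakSet, Set.mem_preimage, Set.mem_ofPred_eq, hx, Equiv.swap_apply_left]
  rw [(Equiv.swap i j).forall_congr_left]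
  simp [Equiv.swap_apply_eq_iff]

theorem finite_setOf_norm_eq (c : ℝ) : {t : 𝕋 | ‖t‖ = c}.Finite := by
  refine ((Set.finite_singleton ((c : ℝ) : 𝕋)).union
    (Set.finite_singleton ((-c : ℝ) : 𝕋))).subset ?_
  intro t ht
  induction t using QuotientAddGroup.induction_on with
  | H x =>
  have hx : |x - round x| = c := by
    simpa [AddCircle.norm_eq] using ht
  have hr : ((x - round x : ℝ) : 𝕋) = x := by
    rw [AddCircle.coe_sub, sub_eq_self]
    exact (AddCircle.coe_eq_zero_iff 1).2 ⟨round x, by simp⟩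
  change (x : 𝕋) = c ∨ (x : 𝕋) = (-c : ℝ)
  rcases (abs_eq (hx ▸ abs_nonneg _)).1 hx with h | h <;> rw [h] at hr
  · exact Or.inl hr.symm
  · exact Or.inr hr.symm

theorem volume_setOf_norm_eq_norm {n : ℕ} {i j : Fin n} (hij : i ≠ j) :
    volume {x : Fin n → 𝕋 | ‖x i‖ = ‖x j‖} = 0 := by
  cases n with
  | zero => exact i.elim0
  | succ n =>
    obtain ⟨l, rfl⟩ := Fin.exists_succAbove_eq hij.symm
    have hS : MeasurableSet {p : 𝕋 × (Fin n → 𝕋) | ‖p.1‖ = ‖p.2 l‖} :=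
      (isClosed_eq (by fun_prop) (by fun_prop)).measurableSet
    have h := (volume_preserving_piFinSuccAbove (fun _ : Fin (n + 1) => 𝕋) i).measure_preimage
      hS.nullMeasurableSet
    refine h.trans ?_
    rw [Measure.volume_eq_prod,
      ← (Measure.measurePreserving_swap (μ := (volume : Measure (Fin n → 𝕋)))).measure_preimage
        hS.nullMeasurableSet, Measure.measure_prod_null (hS.preimage measurable_swap)]
    exact Eventually.of_forall fun y => (finite_setOf_norm_eq ‖y l‖).measure_zero _

theorem exists_mem_peakSet {n : ℕ} [NeZero n] {x : Fin n → 𝕋}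
    (hx : ∀ i j, i ≠ j → ‖x i‖ ≠ ‖x j‖) : ∃ j, x ∈ peakSet n 0 j := by
  obtain ⟨j, hj⟩ := Finite.exists_max fun i => ‖x i‖
  refine ⟨j, fun i hij => ?_⟩
  rw [add_zero]
  exact lt_of_le_of_ne (hj i) (hx i j hij)

theorem volume_peakSet_zero (n : ℕ) [NeZero n] (j : Fin n) :
    volume (peakSet n 0 j) = (n : ENNReal)⁻¹ := by
  have hU : volume (⋃ i, peakSet n 0 i) = 1 := by
    have hae : ∀ᵐ x : Fin n → 𝕋, x ∈ ⋃ i, peakSet n 0 i := by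
      have h : ∀ᵐ x : Fin n → 𝕋, ∀ i j, i ≠ j → ‖x i‖ ≠ ‖x j‖ := by
        simp only [ae_all_iff]
        intro i j hij
        simpa [ae_iff] using volume_setOf_norm_eq_norm hij
      filter_upwards [h] with x hx
      exact Set.mem_iUnion.2 (exists_mem_peakSet hx)
    exact (mem_ae_iff_prob_eq_one
      (isOpen_iUnion fun i => isOpen_peakSet n 0 i).measurableSet).1 hae
  rw [measure_iUnion (fun _ _ h => peakSet_disjoint le_rfl h)
    fun i => (isOpen_peakSet n 0 i).measurableSet, tsum_fintype,
    Finset.sum_congr rfl fun i _ => volume_peakSet_eq n 0 i j] at hU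
  rw [Finset.sum_const, Finset.card_univ, Fintype.card_fin, nsmul_eq_mul, mul_comm] at hU
  exact ENNReal.eq_inv_of_mul_eq_one_left hU

theorem exists_lt_volume_peakSet (n : ℕ) [NeZero n] (j : Fin n) {c : ENNReal}
    (hc : c < (n : ENNReal)⁻¹) : ∃ δ > 0, c < volume (peakSet n δ j) := by
  have hmono : Monotone fun N : ℕ => peakSet n (1 / ((N : ℝ) + 1)) j := by
    intro M N hMN x hx i hij
    have h₁ := hx i hij
    have h₂ := Nat.one_div_le_one_div (α := ℝ) hMN
    linarith
  have hU : peakSet n 0 j ⊆ ⋃ N : ℕ, peakSet n (1 / ((N : ℝ) + 1)) j := by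
    intro x hx
    have hev : ∀ i, ∀ᶠ N : ℕ in atTop, i ≠ j → ‖x i‖ + 1 / ((N : ℝ) + 1) < ‖x j‖ := by
      intro i
      by_cases hij : i = j
      · simp [hij]
      · have ht := (tendsto_one_div_add_atTop_nhds_zero_nat (𝕜 := ℝ)).const_add ‖x i‖
        filter_upwards [ht.eventually_lt_const (hx i hij)] with N hN _ using hN
    obtain ⟨N, hN⟩ := (eventually_all.2 hev).exists
    exact Set.mem_iUnion.2 ⟨N, hN⟩
  have ht := tendsto_measure_iUnion_atTop (μ := volume) hmono
  have hlt : c < volume (⋃ N : ℕ, peakSet n (1 / ((N : ℝ) + 1)) j) :=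
    hc.trans_le ((volume_peakSet_zero n j).symm.le.trans (measure_mono hU))
  obtain ⟨N, hN⟩ := (ht.eventually_const_lt hlt).exists
  exact ⟨_, Nat.one_div_pos_of_nat, hN⟩

/-- The index `2 i + 1` of `Fin (2 k + 3)`. -/
def oddIndex (k : ℕ) (i : Fin (k + 1)) : Fin (2 * k + 3) := ⟨2 * i + 1, by omega⟩

theorem oddIndex_injective (k : ℕ) : Function.Injective (oddIndex k) := by
  intro i j h
  simp only [oddIndex, Fin.mk.injEq] at h
  omega

theorem exists_le_norm_of_mem_add {k : ℕ} {δ : ℝ} {z : Fin (2 * k + 2) → 𝕋}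
    (hz : z ∈ projFirst (2 * k + 2) '' (⋃ i, peakSet (2 * k + 3) δ (oddIndex k i)) +
      projLast (2 * k + 2) '' (⋃ i, peakSet (2 * k + 3) δ (oddIndex k i))) :
    ∃ l, δ ≤ ‖z l‖ := by
  obtain ⟨_, ⟨x, hx, rfl⟩, _, ⟨y, hy, rfl⟩, rfl⟩ := hz
  obtain ⟨a, ha⟩ := Set.mem_iUnion.1 hx
  obtain ⟨b, hb⟩ := Set.mem_iUnion.1 hy
  by_contra! h
  have h' : ∀ l : Fin (2 * k + 2), |‖x l.succ‖ - ‖y l.castSucc‖| < δ := by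
    intro l
    refine lt_of_le_of_lt ?_ (h l)
    simpa [projFirst, projLast] using abs_norm_sub_norm_le (x l.succ) (-y l.castSucc)
  let p : Fin (2 * k + 2) := ⟨2 * a, by omega⟩
  let q : Fin (2 * k + 2) := ⟨2 * b + 1, by omega⟩
  have hp : p.succ = oddIndex k a := rfl
  have hq : q.castSucc = oddIndex k b := rfl
  have h₁ := ha q.succ (by simp [q, oddIndex, Fin.ext_iff]; omega)
  have h₂ := hb p.castSucc (by simp [p, oddIndex, Fin.ext_iff]; omega)
  rw [← hp] at h₁
  rw [← hq] at h₂
  have h₃ := abs_lt.1 (h' p)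
  have h₄ := abs_lt.1 (h' q)
  linarith [h₃.1, h₃.2, h₄.1, h₄.2]

theorem toReal_volume_lt_one_of_exists_le_norm {n : ℕ} {δ : ℝ} (hδ : 0 < δ)
    {S : Set (Fin n → 𝕋)} (hS : ∀ z ∈ S, ∃ l, δ ≤ ‖z l‖) : (volume S).toReal < 1 := by
  have hV : IsOpen {z : Fin n → 𝕋 | ∀ l, ‖z l‖ < δ} := by
    rw [Set.ofPred_forall]
    exact isOpen_iInter_of_finite fun l => isOpen_lt (by fun_prop) continuous_const
  have hpos := hV.measure_pos volume ⟨0, by simpa using fun _ => hδ⟩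
  have hsub : S ⊆ {z : Fin n → 𝕋 | ∀ l, ‖z l‖ < δ}ᶜ := by
    intro z hz hz'
    obtain ⟨l, hl⟩ := hS z hz
    exact (hz' l).not_ge hl
  have hlt : volume S < 1 := by
    refine (measure_mono hsub).trans_lt ?_
    rw [prob_compl_eq_one_sub hV.measurableSet]
    exact ENNReal.sub_lt_self ENNReal.one_ne_top one_ne_zero hpos.ne'
  simpa using (ENNReal.toReal_lt_toReal hlt.ne_top ENNReal.one_ne_top).2 hlt

theorem exTdim_nonneg (m : ℕ) (α : ℝ) : 0 ≤ exTdim m α := by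
  refine Real.sInf_nonneg ?_
  rintro x ⟨B, -, -, rfl⟩
  exact ENNReal.toReal_nonneg

theorem exTdim_le {m : ℕ} {α : ℝ} {B : Set (Fin (m + 1) → 𝕋)} (hB : IsOpen B)
    (hα : α < (volume B).toReal) :
    exTdim m α ≤ (volume (projFirst m '' B + projLast m '' B)).toReal := by
  refine csInf_le ⟨0, ?_⟩ ⟨B, hB, hα, rfl⟩
  rintro x ⟨B, -, -, rfl⟩
  exact ENNReal.toReal_nonneg

theorem exists_mul_lt {α : ℝ} (hα : α < 1 / 2) :
    ∃ k : ℕ, α * (2 * k + 3) < k + 1 := by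
  obtain ⟨k, hk⟩ := exists_nat_gt (3 * α / (1 - 2 * α))
  refine ⟨k, ?_⟩
  rw [div_lt_iff₀ (by linarith)] at hk
  linarith

/-- For every `α ∈ (0, 1/2)`, `ex_T(α) < 1`. -/
theorem exTlim_lt_one :
    ∀ α : ℝ, 0 < α → α < 1 / 2 → exTlim α < 1 := by
  intro α h₀ hα
  obtain ⟨k, hk⟩ := exists_mul_lt hα
  have hc : ENNReal.ofReal (α / (k + 1)) < ((2 * k + 3 : ℕ) : ENNReal)⁻¹ := by
    rw [← ENNReal.ofReal_natCast, ← ENNReal.ofReal_inv_of_pos (by positivity),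
      ENNReal.ofReal_lt_ofReal_iff (by positivity), div_lt_iff₀ (by positivity),
      inv_mul_eq_div, lt_div_iff₀ (by positivity)]
    push_cast
    exact hk
  obtain ⟨δ, hδ, hlt⟩ := exists_lt_volume_peakSet (2 * k + 3) 0 hc
  set B := ⋃ i, peakSet (2 * k + 3) δ (oddIndex k i) with hBdef
  have hB : IsOpen B := isOpen_iUnion fun i => isOpen_peakSet _ _ _
  have hvol : volume B = (k + 1 : ℕ) * volume (peakSet (2 * k + 3) δ 0) := by
    rw [hBdef, measure_iUnion
      (fun _ _ h => peakSet_disjoint hδ.le ((oddIndex_injective k).ne h))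
      fun i => (isOpen_peakSet _ _ _).measurableSet, tsum_fintype,
      Finset.sum_congr rfl fun i _ => volume_peakSet_eq (2 * k + 3) δ (oddIndex k i) 0]
    rw [Finset.sum_const, Finset.card_univ, Fintype.card_fin, nsmul_eq_mul]
  have hαB : α < (volume B).toReal := by
    rw [hvol, ENNReal.toReal_mul, ENNReal.toReal_natCast]
    have := (ENNReal.ofReal_lt_iff_lt_toReal (by positivity) (measure_ne_top _ _)).1 hlt
    rw [div_lt_iff₀ (by positivity)] at this
    push_cast
    linarith
  calc exTlim α ≤ exT (2 * k + 1 + 2) α := by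
        refine ciInf_le ⟨0, ?_⟩ (2 * k + 1)
        rintro _ ⟨n, rfl⟩
        exact exTdim_nonneg _ _
    _ ≤ (volume (projFirst (2 * k + 2) '' B + projLast (2 * k + 2) '' B)).toReal :=
        exTdim_le hB hαB
    _ < 1 := toReal_volume_lt_one_of_exists_le_norm hδ fun z hz => exists_le_norm_of_mem_add hz
end
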